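/- Let l > 0 be an integer and let G be a finite simple graph. If tw(G) ≥ 12l − 4, then G contains as a minor a double wheel DW_r for some integer r > 2 with r ≥ (√l − 2)/(2·log₂ l − 5). -/

import Mathlib

/-- `IsMinor H G` : there is a minor model of `H` in `G`. -/
def IsMinor {α : Type*} {β : Type*} (H : SimpleGraph α) (G : SimpleGraph β) : Prop :=
  ∃ M : α → Set β,
    (∀ v, (G.induce (M v)).Connected) ∧
    (Pairwise fun u v => Disjoint (M u) (M v)) ∧
    (∀ ⦃u v : α⦄, H.Adj u v → ∃ a ∈ M u, ∃ b ∈ M v, G.Adj a b)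

/-- The treewidth of a finite simple graph: the least `w` such that `G` admits a tree
decomposition all of whose bags have at most `w + 1` vertices. -/
noncomputable def treewidth {V : Type*} [Fintype V] (G : SimpleGraph V) : ℕ :=
  sInf { w : ℕ | ∃ (ι : Type) (_ : Fintype ι) (t : SimpleGraph ι) (bag : ι → Finset V),
    t.IsTree ∧
    (∀ v : V, ∃ i, v ∈ bag i) ∧
    (∀ u v : V, G.Adj u v → ∃ i, u ∈ bag i ∧ v ∈ bag i) ∧
    (∀ v : V, (t.induce {i : ι | v ∈ bag i}).Connected) ∧
    (∀ i, (bag i).card ≤ w + 1) }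

/-- The double wheel of order `r` : a cycle `w_1 … w_r` (the `inl` vertices) together
with two hubs `o_1, o_2` (the `inr` vertices), each adjacent to every cycle vertex. -/
def doubleWheel (r : ℕ) : SimpleGraph (Fin r ⊕ Fin 2) :=
  SimpleGraph.fromRel (fun u v =>
    match u, v with
    | Sum.inl i, Sum.inl j => (j : ℕ) = ((i : ℕ) + 1) % r
    | Sum.inl _, Sum.inr _ => True
    | _, _ => False)


namespace DoubleWheelMinor

open SimpleGraph

section Connectivity

variable {V : Type*} {G : SimpleGraph V}

/-- A vertex set that induces a connected subgraph. -/
def ConnSet (G : SimpleGraph V) (s : Set V) : Prop := (G.induce s).Connected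

theorem ConnSet.nonempty {s : Set V} (h : ConnSet G s) : s.Nonempty := by
  obtain ⟨⟨x, hx⟩⟩ := Connected.nonempty h
  exact ⟨x, hx⟩

theorem ConnSet.singleton (v : V) : ConnSet G {v} := by
  have e : {x | x ∈ (Walk.nil : G.Walk v v).support} = {v} := by ext; simp
  exact e ▸ (Walk.nil : G.Walk v v).connected_induce_support

theorem ConnSet.support {u v : V} (p : G.Walk u v) : ConnSet G {x | x ∈ p.support} :=
  p.connected_induce_support

theorem ConnSet.union {s t : Set V} (hs : ConnSet G s) (ht : ConnSet G t)
    (h : (s ∩ t).Nonempty) : ConnSet G (s ∪ t) :=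
  induce_union_connected hs.preconnected ht.preconnected h

theorem ConnSet.union_of_adj {s t : Set V} (hs : ConnSet G s) (ht : ConnSet G t) {a b : V}
    (ha : a ∈ s) (hb : b ∈ t) (h : G.Adj a b) : ConnSet G (s ∪ t) :=
  connected_induce_union hs.preconnected ht.preconnected ha hb h

theorem ConnSet.exists_walk {s : Set V} (hs : ConnSet G s) {a b : V} (ha : a ∈ s) (hb : b ∈ s) :
    ∃ p : G.Walk a b, ∀ x ∈ p.support, x ∈ s := by
  obtain ⟨p⟩ := hs.preconnected ⟨a, ha⟩ ⟨b, hb⟩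
  have key : ∀ x ∈ (p.map (Embedding.induce s).toHom).support, x ∈ s := ?_
  · exact ⟨p.map (Embedding.induce s).toHom, key⟩
  intro x hx
  rw [Walk.support_map] at hx
  obtain ⟨y, -, rfl⟩ := List.mem_map.1 hx
  exact y.2

theorem ConnSet.of_patches {s : Set V} {u : V} (hu : u ∈ s)
    (h : ∀ v ∈ s, ∃ t ⊆ s, u ∈ t ∧ v ∈ t ∧ ConnSet G t) : ConnSet G s := by
  refine induce_connected_of_patches u hu fun {v} hv => ?_
  obtain ⟨t, hts, hut, hvt, ht⟩ := h v hv
  exact ⟨t, hts, hut, hvt, ht.preconnected _ _⟩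

/-- A walk that starts in a set closed under the relevant adjacencies stays in it. -/
theorem walk_subset_of_closed {a b : V} (p : G.Walk a b) {L : Set V} (ha : a ∈ L)
    (h : ∀ u v, u ∈ L → v ∈ p.support → G.Adj u v → v ∈ L) : ∀ x ∈ p.support, x ∈ L := by
  induction p with
  | nil => simpa using ha
  | @cons u v w huv q ih =>
    have hv : v ∈ L := h u v ha (by simp) huv
    intro x hx
    rw [Walk.support_cons, List.mem_cons] at hx
    rcases hx with rfl | hx
    · exact ha
    · exact ih hv (fun u v hu hv' => h u v hu (by simp [hv'])) x hx

theorem ConnSet.subset_of_closed {R L : Set V} (hR : ConnSet G R) (hne : (R ∩ L).Nonempty)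
    (h : ∀ u v, u ∈ R → u ∈ L → v ∈ R → G.Adj u v → v ∈ L) : R ⊆ L := by
  obtain ⟨a, haR, haL⟩ := hne
  intro b hb
  obtain ⟨p, hp⟩ := hR.exists_walk haR hb
  exact (walk_subset_of_closed p (L := R ∩ L) ⟨haR, haL⟩
    (fun u v hu hv huv => ⟨hp v hv, h u v hu.1 hu.2 (hp v hv) huv⟩) b (by simp)).2

/-- The vertices that can be reached from `A` by a walk avoiding `Q`. -/
def reachSet (G : SimpleGraph V) (Q A : Set V) : Set V :=
  {v | ∃ a ∈ A, ∃ p : G.Walk a v, ∀ x ∈ p.support, x ∉ Q}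

theorem subset_reachSet {Q A : Set V} {a : V} (ha : a ∈ A) (hQ : a ∉ Q) : a ∈ reachSet G Q A :=
  ⟨a, ha, Walk.nil, by simpa using hQ⟩

theorem notMem_of_mem_reachSet {Q A : Set V} {v : V} (h : v ∈ reachSet G Q A) : v ∉ Q := by
  obtain ⟨a, -, p, hp⟩ := h
  exact hp v (by simp)

theorem reachSet_adj {Q A : Set V} {u v : V} (hu : u ∈ reachSet G Q A) (huv : G.Adj u v)
    (hv : v ∉ Q) : v ∈ reachSet G Q A := by
  obtain ⟨a, ha, p, hp⟩ := hu
  refine ⟨a, ha, p.concat huv, fun x hx => ?_⟩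
  rw [Walk.support_concat, List.mem_append] at hx
  rcases hx with hx | hx
  · exact hp x hx
  · simp at hx; exact hx ▸ hv

theorem reachSet_singleton_connSet {Q : Set V} {c : V} (hc : c ∉ Q) :
    ConnSet G (reachSet G Q {c}) := by
  refine ConnSet.of_patches (subset_reachSet rfl hc) fun v hv => ?_
  obtain ⟨a, ha, p, hp⟩ := hv
  obtain rfl : a = c := ha
  refine ⟨{x | x ∈ p.support}, fun x hx => ?_, by simp, by simp, ConnSet.support p⟩
  classical
  exact ⟨a, rfl, p.takeUntil x hx, fun y hy => hp y (p.support_takeUntil_subset_support hx hy)⟩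

theorem ConnSet.subset_reachSet {Q R A : Set V} (hR : ConnSet G R) (hRQ : Disjoint R Q)
    (h : (R ∩ reachSet G Q A).Nonempty) : R ⊆ reachSet G Q A :=
  hR.subset_of_closed h fun _ _ _ hu hv huv =>
    reachSet_adj hu huv (Set.disjoint_left.1 hRQ hv)

/-- A connected set avoiding `S` that meets a set `C` with neighbourhood inside `S` lies in `C`. -/
theorem ConnSet.subset_of_boundary {R C S : Set V} (hR : ConnSet G R) (hRS : Disjoint R S)
    (hC : ∀ u ∈ C, ∀ v, G.Adj u v → v ∈ C ∨ v ∈ S) (h : (R ∩ C).Nonempty) : R ⊆ C :=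
  hR.subset_of_closed h fun u v _ hu hv huv =>
    (hC u hu v huv).resolve_right (Set.disjoint_left.1 hRS hv)

/-- Gluing connected sets along a connected index set. -/
theorem ConnSet.iUnion {ι : Type*} {D : SimpleGraph ι} {I : Set ι} (hI : ConnSet D I)
    {f : ι → Set V} (hf : ∀ i ∈ I, ConnSet G (f i))
    (h : ∀ i ∈ I, ∀ j ∈ I, D.Adj i j → ConnSet G (f i ∪ f j)) :
    ConnSet G {v | ∃ i ∈ I, v ∈ f i} := by
  obtain ⟨i₀, hi₀⟩ := hI.nonempty
  obtain ⟨u, hu⟩ := (hf i₀ hi₀).nonempty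
  refine ConnSet.of_patches (u := u) ⟨i₀, hi₀, hu⟩ ?_
  have key : I ⊆ {i | ∃ t ⊆ {v | ∃ i ∈ I, v ∈ f i}, u ∈ t ∧ f i ⊆ t ∧ ConnSet G t} := by
    refine hI.subset_of_closed
      ⟨i₀, hi₀, f i₀, fun v hv => ⟨i₀, hi₀, hv⟩, hu, subset_rfl, hf i₀ hi₀⟩ ?_
    rintro i j hi ⟨t, ht, hut, hit, htc⟩ hj hij
    obtain ⟨a, ha⟩ := (hf i hi).nonempty
    refine ⟨t ∪ (f i ∪ f j), Set.union_subset ht (Set.union_subset (hit.trans ht)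
      fun v hv => ⟨j, hj, hv⟩), Or.inl hut, fun v hv => Or.inr (Or.inr hv),
      htc.union (h i hi j hj hij) ⟨a, hit ha, Or.inl ha⟩⟩
  rintro v ⟨i, hi, hv⟩
  obtain ⟨t, ht, hut, hit, htc⟩ := key hi
  exact ⟨t, ht, hut, hit hv, htc⟩

theorem ConnSet.iUnion_of_adj {ι : Type*} {D : SimpleGraph ι} {I : Set ι} (hI : ConnSet D I)
    {f : ι → Set V} (hf : ∀ i ∈ I, ConnSet G (f i))
    (h : ∀ i ∈ I, ∀ j ∈ I, D.Adj i j → ∃ a ∈ f i, ∃ b ∈ f j, G.Adj a b) :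
    ConnSet G {v | ∃ i ∈ I, v ∈ f i} := by
  refine hI.iUnion hf fun i hi j hj hij => ?_
  obtain ⟨a, ha, b, hb, hab⟩ := h i hi j hj hij
  exact (hf i hi).union_of_adj (hf j hj) ha hb hab

theorem ConnSet.image {ι : Type*} {D : SimpleGraph ι} {I : Set ι} (hI : ConnSet D I)
    (f : D →g G) : ConnSet G (f '' I) := by
  have h := hI.iUnion_of_adj (f := fun i => {f i}) (fun i _ => ConnSet.singleton (f i))
    fun i _ j _ hij => ⟨f i, rfl, f j, rfl, f.map_adj hij⟩
  convert h using 1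
  ext v
  simp [eq_comm]

theorem ConnSet.mono_graph {H : SimpleGraph V} (hHG : H ≤ G) {s : Set V} (h : ConnSet H s) :
    ConnSet G s := by
  refine Connected.mono ?_ h
  exact fun a b hab => hHG hab

/-- Unions of consecutively adjacent connected sets over order-convex index sets are connected. -/
theorem ConnSet.iUnion_ordConnected {f : ℕ → Set V} {I : Set ℕ} (hne : I.Nonempty)
    (hI : ∀ i ∈ I, ∀ k ∈ I, ∀ j, i ≤ j → j ≤ k → j ∈ I)
    (hf : ∀ i ∈ I, ConnSet G (f i))
    (h : ∀ i, i ∈ I → i + 1 ∈ I → ∃ a ∈ f i, ∃ b ∈ f (i + 1), G.Adj a b) :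
    ConnSet G {v | ∃ i ∈ I, v ∈ f i} := by
  classical
  obtain ⟨i₀, hi₀, hmin⟩ : ∃ i₀ ∈ I, ∀ j ∈ I, i₀ ≤ j :=
    ⟨Nat.find hne, Nat.find_spec hne, fun j hj => Nat.find_min' hne hj⟩
  obtain ⟨u, hu⟩ := (hf i₀ hi₀).nonempty
  refine ConnSet.of_patches (u := u) ⟨i₀, hi₀, hu⟩ ?_
  have key : ∀ d, i₀ + d ∈ I →
      ∃ t ⊆ {v | ∃ i ∈ I, v ∈ f i}, u ∈ t ∧ f (i₀ + d) ⊆ t ∧ ConnSet G t := by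
    intro d
    induction d with
    | zero => exact fun _ => ⟨f i₀, fun v hv => ⟨i₀, hi₀, hv⟩, hu, subset_rfl, hf i₀ hi₀⟩
    | succ d ih =>
      intro hd
      have hd' : i₀ + d ∈ I := hI i₀ hi₀ _ hd _ (by omega) (by omega)
      obtain ⟨t, ht, hut, hit, htc⟩ := ih hd'
      obtain ⟨a, ha, b, hb, hab⟩ := h _ hd' hd
      exact ⟨t ∪ f (i₀ + (d + 1)), Set.union_subset ht fun v hv => ⟨_, hd, hv⟩, Or.inl hut,
        Set.subset_union_right, htc.union_of_adj (hf _ hd) (hit ha) hb hab⟩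
  rintro v ⟨i, hi, hv⟩
  obtain ⟨d, rfl⟩ := Nat.exists_eq_add_of_le (hmin i hi)
  obtain ⟨t, ht, hut, hit, htc⟩ := key d hi
  exact ⟨t, ht, hut, hit hv, htc⟩

end Connectivity

section Menger

variable {V : Type*} {G : SimpleGraph V}

/-- Every walk from `A` to `B` meets `Q`. -/
def Separates (G : SimpleGraph V) (A B Q : Finset V) : Prop :=
  ∀ a ∈ A, ∀ b ∈ B, ∀ p : G.Walk a b, ∃ q ∈ Q, q ∈ p.support

/-- There are `k` pairwise disjoint paths from `A` to `B`. -/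
def Linked (G : SimpleGraph V) (A B : Finset V) (k : ℕ) : Prop :=
  ∃ (a b : Fin k → V) (p : ∀ i, G.Walk (a i) (b i)),
    (∀ i, a i ∈ A ∧ b i ∈ B ∧ (p i).IsPath) ∧
    ∀ i j v, v ∈ (p i).support → v ∈ (p j).support → i = j

theorem Separates.disjoint_reachSet {A B S : Finset V} (h : Separates G A B S) :
    Disjoint (reachSet G (S : Set V) A) (reachSet G (S : Set V) B) := by
  rw [Set.disjoint_left]
  rintro v ⟨a, ha, p, hp⟩ ⟨b, hb, q, hq⟩
  obtain ⟨s, hs, hsp⟩ := h a ha b hb (p.append q.reverse)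
  rw [Walk.mem_support_append_iff, Walk.support_reverse, List.mem_reverse] at hsp
  rcases hsp with hsp | hsp
  · exact hp s hsp hs
  · exact hq s hsp hs

theorem Separates.symm {A B S : Finset V} (h : Separates G A B S) : Separates G B A S := by
  intro b hb a ha p
  obtain ⟨q, hq, hqp⟩ := h a ha b hb p.reverse
  exact ⟨q, hq, by simpa using hqp⟩

theorem deleteEdge_adj {x y u v : V} (huv : G.Adj u v)
    (h : ¬ (u = x ∧ v = y)) (h' : ¬ (u = y ∧ v = x)) : (G.deleteEdges {s(x, y)}).Adj u v := by
  rw [deleteEdges_adj]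
  refine ⟨huv, fun hmem => ?_⟩
  rw [Set.mem_singleton_iff, Sym2.eq_iff] at hmem
  exact hmem.elim h h'

theorem separates_of_separates_deleteEdges [DecidableEq V] {A B S T : Finset V} {x y : V}
    (hS : Separates (G.deleteEdges {s(x, y)}) A B S)
    (hy : y ∉ reachSet (G.deleteEdges {s(x, y)}) (S : Set V) A)
    (hT : Separates (G.deleteEdges {s(x, y)}) A (insert x S) T) : Separates G A B T := by
  set H := G.deleteEdges {s(x, y)}
  intro a ha b hb p
  by_contra! hcon
  have hKP : ∀ v ∈ reachSet H (T : Set V) A, v ∉ insert x S := by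
    rintro v ⟨a, ha, q, hq⟩ hv
    obtain ⟨t, ht, htq⟩ := hT a ha v hv q
    exact hq t htq ht
  have hKR : reachSet H (T : Set V) A ⊆ reachSet H (S : Set V) A := by
    rintro v ⟨a, ha, q, hq⟩
    refine ⟨a, ha, q, fun z hz hzS => hKP z ?_ (Finset.mem_insert_of_mem hzS)⟩
    exact ⟨a, ha, q.takeUntil z hz,
      fun u hu => hq u (q.support_takeUntil_subset_support hz hu)⟩
  have hbK := walk_subset_of_closed p (L := reachSet H (T : Set V) A)
    (subset_reachSet ha fun h => hcon a h (by simp)) (by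
      intro u v hu hv huv
      refine reachSet_adj hu (deleteEdge_adj huv ?_ ?_) fun h => hcon v h hv
      · rintro ⟨rfl, -⟩
        exact hKP u hu (by simp)
      · rintro ⟨rfl, -⟩
        exact hy (hKR hu)) b (by simp)
  refine Set.disjoint_left.1 hS.disjoint_reachSet (hKR hbK) (subset_reachSet hb fun h => ?_)
  exact hKP b hbK (Finset.mem_insert_of_mem h)

theorem exists_apply_eq {S : Finset V} {k : ℕ} {z : Fin k → V} (hinj : Function.Injective z)
    (hmem : ∀ i, z i ∈ S) (hcard : S.card ≤ k) : ∀ s ∈ S, ∃ i, z i = s := by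
  classical
  have : Finset.univ.image z = S := by
    refine Finset.eq_of_subset_of_card_le (fun s hs => ?_) ?_
    · obtain ⟨i, -, rfl⟩ := Finset.mem_image.1 hs
      exact hmem i
    · simpa [Finset.card_image_of_injective _ hinj] using hcard
  intro s hs
  rw [← this] at hs
  simpa using hs

theorem injective_start {k : ℕ} {a z : Fin k → V} {p : ∀ i, G.Walk (a i) (z i)}
    (hd : ∀ i j v, v ∈ (p i).support → v ∈ (p j).support → i = j) : Function.Injective a :=
  fun i j hij =>
    hd i j (a i) (by simp) ((congrArg (· ∈ (p j).support) hij).mpr (p j).start_mem_support)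

theorem injective_end {k : ℕ} {a z : Fin k → V} {p : ∀ i, G.Walk (a i) (z i)}
    (hd : ∀ i j v, v ∈ (p i).support → v ∈ (p j).support → i = j) : Function.Injective z :=
  fun i j hij =>
    hd i j (z i) (by simp) ((congrArg (· ∈ (p j).support) hij).mpr (p j).end_mem_support)

theorem mem_path_to_separator [DecidableEq V] {A S : Finset V} {x : V} {k : ℕ}
    (hcard : (insert x S).card = k) {a z : Fin k → V} {p : ∀ i, G.Walk (a i) (z i)}
    (hp : ∀ i, a i ∈ A ∧ z i ∈ insert x S ∧ (p i).IsPath)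
    (hdisj : ∀ i j v, v ∈ (p i).support → v ∈ (p j).support → i = j)
    (hx : x ∈ reachSet G (S : Set V) A) :
    (∀ s ∈ insert x S, ∃ i, z i = s) ∧
    ∀ i, ∀ v ∈ (p i).support, v ∈ reachSet G (S : Set V) A ∨ (v = z i ∧ v ∈ S) := by
  have hsurj := exists_apply_eq (injective_end hdisj) (fun i => (hp i).2.1) hcard.le
  refine ⟨hsurj, fun i v hv => ?_⟩
  by_cases hvz : z i = v
  · rcases Finset.mem_insert.1 (hvz ▸ (hp i).2.1) with h | h
    · exact Or.inl (h ▸ hx)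
    · exact Or.inr ⟨hvz.symm, h⟩
  · refine Or.inl ⟨a i, (hp i).1, (p i).takeUntil v hv, fun u hu huS => ?_⟩
    have hup := (p i).support_takeUntil_subset_support hv hu
    obtain ⟨j, rfl⟩ := hsurj u (Finset.mem_insert_of_mem huS)
    obtain rfl := hdisj i j _ hup (by simp)
    exact Walk.endpoint_notMem_support_takeUntil (hp i).2.2 hv hvz hu

theorem Linked.mono {H : SimpleGraph V} (hHG : H ≤ G) {A B : Finset V} {k : ℕ}
    (h : Linked H A B k) : Linked G A B k := by
  obtain ⟨a, b, p, hp, hd⟩ := h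
  refine ⟨a, b, fun i => (p i).mapLe hHG, fun i => ⟨(hp i).1, (hp i).2.1, ?_⟩, ?_⟩
  · exact (hp i).2.2.mapLe hHG
  · intro i j v hi hj
    rw [Walk.support_mapLe_eq_support] at hi hj
    exact hd i j v hi hj

theorem linked_bot [DecidableEq V] {A B : Finset V} {k : ℕ} (hk : k ≤ (A ∩ B).card) :
    Linked G A B k := by
  let e := (A ∩ B).equivFin.symm
  have hmem : ∀ i : Fin k, ((e (Fin.castLE hk i) : V)) ∈ A ∩ B := fun i => (e _).2
  refine ⟨fun i => e (Fin.castLE hk i), fun i => e (Fin.castLE hk i), fun i => Walk.nil,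
    fun i => ⟨(Finset.mem_inter.1 (hmem i)).1, (Finset.mem_inter.1 (hmem i)).2, by simp⟩, ?_⟩
  intro i j v hi hj
  simp only [Walk.support_nil, List.mem_singleton] at hi hj
  have := e.injective (Subtype.ext (hi.symm.trans hj))
  exact Fin.castLE_injective hk this

/-- **Menger's theorem**, vertex version for two sets. -/
theorem menger [Finite V] (G : SimpleGraph V) (A B : Finset V) (k : ℕ)
    (h : ∀ Q, Separates G A B Q → k ≤ Q.card) : Linked G A B k := by
  classical
  induction hn : G.edgeSet.ncard using Nat.strong_induction_on generalizing G A B with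
  | _ n ih =>
  by_cases hbot : G = ⊥
  · refine linked_bot (h _ fun a ha b hb p => ?_)
    subst hbot
    cases p with
    | nil => exact ⟨a, by simp [ha, hb], by simp⟩
    | cons h _ => exact h.elim
  obtain ⟨x₀, y₀, hxy₀⟩ : ∃ x y, G.Adj x y := by
    by_contra! hcon
    exact hbot (by ext a b; simpa using hcon a b)
  by_cases hH : ∀ Q, Separates (G.deleteEdges {s(x₀, y₀)}) A B Q → k ≤ Q.card
  · refine (ih _ ?_ _ A B hH rfl).mono (deleteEdges_le _)
    rw [← hn, edgeSet_deleteEdges]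
    exact Set.ncard_sdiff_singleton_lt_of_mem hxy₀ (Set.toFinite _)
  push Not at hH
  obtain ⟨S, hS₀, hSk⟩ := hH
  obtain ⟨x, y, hxy, hS, hxA, hyB⟩ : ∃ x y, G.Adj x y ∧
      Separates (G.deleteEdges {s(x, y)}) A B S ∧
      x ∈ reachSet (G.deleteEdges {s(x, y)}) (S : Set V) A ∧
      y ∈ reachSet (G.deleteEdges {s(x, y)}) (S : Set V) B := by
    have aux : ∀ A' B' : Finset V, (∀ Q, Separates G A' B' Q → k ≤ Q.card) →
        Separates (G.deleteEdges {s(x₀, y₀)}) A' B' S →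
        x₀ ∈ reachSet (G.deleteEdges {s(x₀, y₀)}) (S : Set V) A' ∨
        y₀ ∈ reachSet (G.deleteEdges {s(x₀, y₀)}) (S : Set V) A' := by
      intro A' B' hAB hS'
      by_contra! hcon
      refine absurd (hAB S fun a ha b hb p => ?_) (by omega)
      by_contra! hp
      have := walk_subset_of_closed p (L := reachSet (G.deleteEdges {s(x₀, y₀)}) (S : Set V) A')
        (subset_reachSet ha fun h => hp a h (by simp)) (by
          intro u v hu hv huv
          refine reachSet_adj hu (deleteEdge_adj huv ?_ ?_) fun h => hp v h hv
          · rintro ⟨rfl, -⟩; exact hcon.1 hu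
          · rintro ⟨rfl, -⟩; exact hcon.2 hu) b (by simp)
      exact Set.disjoint_left.1 hS'.disjoint_reachSet this
        (subset_reachSet hb fun h => hp b h (by simp))
    have hd := Set.disjoint_left.1 hS₀.disjoint_reachSet
    have hswap : s(y₀, x₀) = s(x₀, y₀) := Sym2.eq_swap
    rcases aux A B h hS₀ with hA | hA <;>
      rcases aux B A (fun Q hQ => h Q hQ.symm) hS₀.symm with hB | hB
    · exact absurd hB (hd hA)
    · exact ⟨x₀, y₀, hxy₀, hS₀, hA, hB⟩
    · exact ⟨y₀, x₀, hxy₀.symm, by rwa [hswap], by rwa [hswap], by rwa [hswap]⟩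
    · exact absurd hB (hd hA)
  set H := G.deleteEdges {s(x, y)} with hHdef
  have hHcard : H.edgeSet.ncard < n := by
    rw [← hn, hHdef, edgeSet_deleteEdges]
    exact Set.ncard_sdiff_singleton_lt_of_mem hxy (Set.toFinite _)
  have hd := Set.disjoint_left.1 hS.disjoint_reachSet
  have hswap : s(y, x) = s(x, y) := Sym2.eq_swap
  have hHs : G.deleteEdges {s(y, x)} = H := by rw [hswap]
  have hTA : ∀ T, Separates H A (insert x S) T → k ≤ T.card := fun T hT =>
    h T (separates_of_separates_deleteEdges hS (fun hy => hd hy hyB) hT)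
  have hTB : ∀ T, Separates H B (insert y S) T → k ≤ T.card := fun T hT =>
    h T (separates_of_separates_deleteEdges (x := y) (y := x) (hHs ▸ hS.symm)
      (fun hx => hd hxA (hHs ▸ hx)) (hHs ▸ hT)).symm
  have hcardS : ∀ (C : Finset V) (c : V),
      (∀ T, Separates H C (insert c S) T → k ≤ T.card) → (insert c S).card = k := by
    intro C c hC
    have h1 := hC (insert c S) fun a _ b hb p => ⟨b, hb, by simp⟩
    have h2 := Finset.card_insert_le c S
    omega
  obtain ⟨a, z, p, hp, hpd⟩ := ih _ hHcard H A (insert x S) hTA rfl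
  obtain ⟨b, w, q, hq, hqd⟩ := ih _ hHcard H B (insert y S) hTB rfl
  obtain ⟨hz, hpm⟩ := mem_path_to_separator (hcardS A x hTA) hp hpd hxA
  obtain ⟨hw, hqm⟩ := mem_path_to_separator (hcardS B y hTB) hq hqd hyB
  have hxS : x ∉ S := notMem_of_mem_reachSet hxA
  have hyS : y ∉ S := notMem_of_mem_reachSet hyB
  have hpS : ∀ i, z i ≠ x → z i ∈ S := fun i hi =>
    (Finset.mem_insert.1 (hp i).2.1).resolve_left hi
  have hj : ∀ i, ∃ j, w j = if z i = x then y else z i := by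
    intro i
    refine hw _ ?_
    split_ifs with hi
    · simp
    · exact Finset.mem_insert_of_mem (hpS i hi)
  choose j hj using hj
  have hzinj := injective_end hpd
  have hjinj : Function.Injective j := by
    intro i i' hii
    apply hzinj
    have h1 := hj i
    rw [hii, hj i'] at h1
    split_ifs at h1 with h2 h3 h3
    · rw [h2, h3]
    · exact absurd (h1 ▸ hpS i h3) hyS
    · exact absurd (h1.symm ▸ hpS i' h2) hyS
    · exact h1.symm
  have hwalk : ∀ i, ∃ r : G.Walk (a i) (b (j i)), r.IsPath ∧ ∀ v ∈ r.support,
      v ∈ (p i).support ∨ v ∈ (q (j i)).support := by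
    intro i
    have hle : H ≤ G := deleteEdges_le _
    obtain ⟨r, hr⟩ : ∃ r : G.Walk (a i) (b (j i)), ∀ v ∈ r.support,
        v ∈ (p i).support ∨ v ∈ (q (j i)).support := by
      have hji := hj i
      split_ifs at hji with hi
      · have hadj : G.Adj (z i) (w (j i)) := by rw [hi, hji]; exact hxy
        refine ⟨((p i).mapLe hle).append (Walk.cons hadj ((q (j i)).mapLe hle).reverse), ?_⟩
        intro v hv
        rw [Walk.mem_support_append_iff, Walk.support_cons, List.mem_cons,
          Walk.support_reverse, List.mem_reverse, Walk.support_mapLe_eq_support,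
          Walk.support_mapLe_eq_support] at hv
        rcases hv with hv | rfl | hv
        · exact Or.inl hv
        · exact Or.inl (by simp)
        · exact Or.inr hv
      · refine ⟨((p i).mapLe hle).append ((((q (j i)).mapLe hle).reverse).copy hji rfl), ?_⟩
        intro v hv
        rw [Walk.mem_support_append_iff, Walk.support_copy,
          Walk.support_reverse, List.mem_reverse, Walk.support_mapLe_eq_support,
          Walk.support_mapLe_eq_support] at hv
        exact hv
    exact ⟨r.bypass, r.bypass_isPath, fun v hv => hr v (r.support_bypass_subset_support hv)⟩
  choose r hr hrs using hwalk
  refine ⟨a, fun i => b (j i), r, fun i => ⟨(hp i).1, (hq _).1, hr i⟩, ?_⟩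
  have hcross : ∀ i i' v, v ∈ (p i).support → v ∈ (q (j i')).support → i = i' := by
    intro i i' v hv hv'
    rcases hpm i v hv with h1 | ⟨h1, h1S⟩
    · rcases hqm _ v hv' with h2 | ⟨-, h2⟩
      · exact absurd h2 (hd h1)
      · exact absurd h2 (notMem_of_mem_reachSet h1)
    · rcases hqm _ v hv' with h2 | ⟨h2, -⟩
      · exact absurd h1S (notMem_of_mem_reachSet h2)
      · rw [hj i'] at h2
        split_ifs at h2 with h3
        · exact absurd (h2 ▸ h1S) hyS
        · exact hzinj (h1.symm.trans h2)
  intro i i' v hv hv'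
  rcases hrs i v hv with h1 | h1 <;> rcases hrs i' v hv' with h2 | h2
  · exact hpd i i' v h1 h2
  · exact hcross i i' v h1 h2
  · exact (hcross i' i v h2 h1).symm
  · exact hjinj (hqd _ _ v h1 h2)

end Menger

section TreeDecomposition

variable {V : Type*} {G : SimpleGraph V}

/-- The tree `t` with bags `bag` is a tree decomposition of the subgraph of `G` induced on `W`. -/
structure IsTreeDec {ι : Type} (G : SimpleGraph V) (W : Set V) (t : SimpleGraph ι)
    (bag : ι → Finset V) : Prop where
  isTree : t.IsTree
  subset : ∀ i, ∀ v ∈ bag i, v ∈ W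
  edge : ∀ u ∈ W, ∀ v ∈ W, G.Adj u v → ∃ i, u ∈ bag i ∧ v ∈ bag i
  connSet : ∀ v ∈ W, ConnSet t {i | v ∈ bag i}

/-- There is a tree decomposition on `W` with root bag `X` whose bags all satisfy `P`. -/
def HasTreeDec (G : SimpleGraph V) (W : Set V) (P : Finset V → Prop) (X : Finset V) : Prop :=
  ∃ (ι : Type) (_ : Fintype ι) (t : SimpleGraph ι) (bag : ι → Finset V) (r : ι),
    IsTreeDec G W t bag ∧ bag r = X ∧ ∀ i, P (bag i)

theorem isTree_sum_sup_edge {ι κ : Type} [Finite ι] [Finite κ] {t : SimpleGraph ι}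
    {t' : SimpleGraph κ} (h : t.IsTree) (h' : t'.IsTree) (r : ι) (r' : κ) :
    ((t ⊕g t') ⊔ edge (Sum.inl r) (Sum.inr r')).IsTree := by
  rw [isTree_iff_connected_and_card] at *
  refine ⟨h.1.sum_sup_edge h'.1, ?_⟩
  have hne : (Sum.inl r : ι ⊕ κ) ≠ Sum.inr r' := by simp
  rw [edgeSet_sup, edgeSet_edge_of_ne hne, Set.union_singleton, Nat.card_coe_set_eq,
    Set.ncard_insert_of_notMem (by simp), ← Nat.card_coe_set_eq,
    Nat.card_congr edgeSetSumEquiv, Nat.card_sum, Nat.card_sum, ← h.2, ← h'.2]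
  omega

theorem hasTreeDec_self {P : Finset V → Prop} {X : Finset V} (hX : P X) :
    HasTreeDec G X P X := by
  refine ⟨Unit, inferInstance, ⊥, fun _ => X, (), ⟨IsTree.of_subsingleton, fun _ _ h => h,
    fun u hu v hv _ => ⟨(), hu, hv⟩, fun v hv => ?_⟩, rfl, fun _ => hX⟩
  have : {i : Unit | v ∈ X} = {()} := by ext; simpa using hv
  rw [this]
  exact ConnSet.singleton _

theorem HasTreeDec.glue {W W' : Set V} {P : Finset V → Prop} {X X' : Finset V}
    (h : HasTreeDec G W P X) (h' : HasTreeDec G W' P X')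
    (hX : ∀ v ∈ W, v ∈ W' → v ∈ X ∧ v ∈ X')
    (hadj : ∀ u ∈ W, ∀ v ∈ W', G.Adj u v → u ∈ W' ∨ v ∈ W) :
    HasTreeDec G (W ∪ W') P X := by
  obtain ⟨ι, _, t, bag, r, ht, rfl, hP⟩ := h
  obtain ⟨ι', _, t', bag', r', ht', rfl, hP'⟩ := h'
  let f : t →g ((t ⊕g t') ⊔ edge (Sum.inl r) (Sum.inr r')) :=
    (Hom.ofLE le_sup_left).comp Embedding.sumInl.toHom
  let g : t' →g ((t ⊕g t') ⊔ edge (Sum.inl r) (Sum.inr r')) :=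
    (Hom.ofLE le_sup_left).comp Embedding.sumInr.toHom
  refine ⟨ι ⊕ ι', inferInstance, (t ⊕g t') ⊔ edge (Sum.inl r) (Sum.inr r'), Sum.elim bag bag',
    Sum.inl r, ⟨isTree_sum_sup_edge ht.isTree ht'.isTree r r', ?_, ?_, ?_⟩, rfl, ?_⟩
  · rintro (i | i) v hv
    · exact Or.inl (ht.subset i v hv)
    · exact Or.inr (ht'.subset i v hv)
  · have h1 : ∀ u ∈ W, ∀ v ∈ W, G.Adj u v →
        ∃ i, u ∈ Sum.elim bag bag' i ∧ v ∈ Sum.elim bag bag' i := fun u hu v hv huv =>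
      (ht.edge u hu v hv huv).elim fun i hi => ⟨Sum.inl i, hi⟩
    have h2 : ∀ u ∈ W', ∀ v ∈ W', G.Adj u v →
        ∃ i, u ∈ Sum.elim bag bag' i ∧ v ∈ Sum.elim bag bag' i := fun u hu v hv huv =>
      (ht'.edge u hu v hv huv).elim fun i hi => ⟨Sum.inr i, hi⟩
    rintro u (hu | hu) v (hv | hv) huv
    · exact h1 u hu v hv huv
    · rcases hadj u hu v hv huv with h | h
      · exact h2 u h v hv huv
      · exact h1 u hu v h huv
    · rcases hadj v hv u hu huv.symm with h | h
      · exact h2 u hu v h huv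
      · exact h1 u h v hv huv
    · exact h2 u hu v hv huv
  · intro v hv
    have e : {i | v ∈ Sum.elim bag bag' i} = f '' {i | v ∈ bag i} ∪ g '' {i | v ∈ bag' i} := by
      ext (i | i) <;> simp [f, g]
    rw [e]
    by_cases hW : v ∈ W <;> by_cases hW' : v ∈ W'
    · refine ((ht.connSet v hW).image f).union_of_adj ((ht'.connSet v hW').image g)
        (a := Sum.inl r) (b := Sum.inr r') ⟨r, (hX v hW hW').1, rfl⟩ ⟨r', (hX v hW hW').2, rfl⟩ ?_
      exact Or.inr (by simp [edge_adj])
    · have : {i | v ∈ bag' i} = ∅ := by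
        ext i; simpa using fun h => hW' (ht'.subset i v h)
      rw [this, Set.image_empty, Set.union_empty]
      exact (ht.connSet v hW).image f
    · have : {i | v ∈ bag i} = ∅ := by
        ext i; simpa using fun h => hW (ht.subset i v h)
      rw [this, Set.image_empty, Set.empty_union]
      exact (ht'.connSet v hW').image g
    · exact (hv.elim hW hW').elim
  · rintro (i | i)
    · exact hP i
    · exact hP' i

theorem IsTreeDec.connSet_meeting {ι : Type} {W : Set V} {t : SimpleGraph ι}
    {bag : ι → Finset V} (h : IsTreeDec G W t bag) {R : Set V} (hR : ConnSet G R) (hRW : R ⊆ W) :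
    ConnSet t {i | ∃ v ∈ R, v ∈ bag i} := by
  refine hR.iUnion (fun v hv => h.connSet v (hRW hv)) fun u hu v hv huv => ?_
  obtain ⟨i, hi⟩ := h.edge u (hRW hu) v (hRW hv) huv
  exact (h.connSet u (hRW hu)).union (h.connSet v (hRW hv)) ⟨i, hi⟩

theorem support_subset_of_isTree {ι : Type} {t : SimpleGraph ι} (ht : t.IsTree) {A : Set ι}
    (hA : ConnSet t A) {i j : ι} (hi : i ∈ A) (hj : j ∈ A) {p : t.Walk i j} (hp : p.IsPath) :
    ∀ x ∈ p.support, x ∈ A := by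
  classical
  obtain ⟨q, hq⟩ := hA.exists_walk hi hj
  have := (ht.isAcyclic.subsingleton_path i j).elim ⟨p, hp⟩ ⟨q.bypass, q.bypass_isPath⟩
  rw [Subtype.mk.injEq] at this
  intro x hx
  rw [this] at hx
  exact hq x (q.support_bypass_subset_support hx)

end TreeDecomposition

section Bramble

variable {V : Type*} {G : SimpleGraph V}

/-- A bramble: a family of pairwise touching connected sets. -/
def IsBramble (G : SimpleGraph V) (𝔅 : Set (Set V)) : Prop :=
  (∀ B ∈ 𝔅, ConnSet G B) ∧ ∀ B ∈ 𝔅, ∀ B' ∈ 𝔅, ConnSet G (B ∪ B')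

/-- `X` meets every member of `𝔅`. -/
def Covers (X : Finset V) (𝔅 : Set (Set V)) : Prop := ∀ B ∈ 𝔅, ∃ x ∈ X, x ∈ B

/-- `X` is not a cover of `𝔅` with more than `k` elements. -/
def Admissible (k : ℕ) (𝔅 : Set (Set V)) (X : Finset V) : Prop := k < X.card → ¬ Covers X 𝔅

theorem hasTreeDec_of_not_touching [DecidableEq V] {P : Finset V → Prop} {X Y : Finset V}
    {C : Set V} (hX : P X) (hY : P Y)
    (hYC : ∀ v, v ∈ Y ↔ v ∈ C ∨ (v ∈ X ∧ ∃ c ∈ C, G.Adj c v)) :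
    HasTreeDec G (X ∪ C) P X := by
  have e : (X : Set V) ∪ C = (X : Set V) ∪ (Y : Set V) := by
    ext v
    simp only [Set.mem_union, Finset.mem_coe, hYC]
    tauto
  rw [e]
  refine (hasTreeDec_self hX).glue (hasTreeDec_self hY) (fun v hv hv' => ⟨hv, hv'⟩) ?_
  intro u hu v hv huv
  rcases (hYC v).1 hv with h | h
  · exact Or.inl ((hYC u).2 (Or.inr ⟨hu, v, h, huv.symm⟩))
  · exact Or.inr h.1

/-- The paths inside `G - C` from a cover `Y` of the bramble to a minimum cover `X`. -/
theorem exists_linkage_avoiding [Finite V] {𝔅 : Set (Set V)} (h𝔅 : IsBramble G 𝔅)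
    {X Y : Finset V} (hX : Covers X 𝔅) (hmin : ∀ Z, Covers Z 𝔅 → X.card ≤ Z.card) {C : Set V}
    (hC : ∀ u ∈ C, ∀ v, G.Adj u v → v ∈ C ∨ v ∈ (X : Set V))
    (hY : Covers Y 𝔅) (hCY : ∀ y ∈ Y, y ∉ C) :
    ∃ R : V → Set V, (∀ x ∈ X, x ∈ R x ∧ ConnSet G (R x) ∧ Disjoint (R x) C ∧ ∃ y ∈ Y, y ∈ R x) ∧
      ∀ x ∈ X, ∀ x' ∈ X, ∀ v, v ∈ R x → v ∈ R x' → x = x' := by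
  classical
  let H : SimpleGraph V :=
    { Adj := fun u v => G.Adj u v ∧ u ∉ C ∧ v ∉ C
      symm := ⟨fun u v h => ⟨h.1.symm, h.2.2, h.2.1⟩⟩
      loopless := ⟨fun u h => G.loopless.irrefl u h.1⟩ }
  have hHG : H ≤ G := fun u v h => h.1
  obtain ⟨a, b, p, hp, hd⟩ := menger H Y X X.card (by
    refine fun Q hQ => hmin Q fun B hB => ?_
    by_contra! hBQ
    obtain ⟨y, hyY, hyB⟩ := hY B hB
    obtain ⟨x, hxX, hxB⟩ := hX B hB
    have hKX : ∀ v ∈ reachSet H (Q : Set V) Y, v ∉ X := by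
      rintro v ⟨a, ha, q, hq⟩ hv
      obtain ⟨z, hz, hzq⟩ := hQ a ha v hv q
      exact hq z hzq hz
    have hKC : ∀ v ∈ reachSet H (Q : Set V) Y, v ∉ C := by
      rintro v ⟨a, ha, q, -⟩
      exact walk_subset_of_closed q (L := Cᶜ) (hCY a ha) (fun u v _ _ huv => huv.2.2) v (by simp)
    have := (h𝔅.1 B hB).subset_of_closed (L := reachSet H (Q : Set V) Y)
      ⟨y, hyB, subset_reachSet hyY fun h => hBQ y h hyB⟩ (by
        intro u v hu huK hv huv
        have huC := hKC u huK
        by_cases hvC : v ∈ C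
        · exact ((hC v hvC u huv.symm).elim huC (hKX u huK)).elim
        · exact reachSet_adj huK (show H.Adj u v from ⟨huv, huC, hvC⟩) fun h => hBQ v h hv)
    exact hKX x (this hxB) hxX)
  have hb := exists_apply_eq (injective_end hd) (fun i => (hp i).2.1) le_rfl
  refine ⟨fun x => {v | ∃ i, b i = x ∧ v ∈ (p i).support}, fun x hx => ?_, ?_⟩
  · obtain ⟨i, rfl⟩ := hb x hx
    have e : {v | ∃ j, b j = b i ∧ v ∈ (p j).support} = {v | v ∈ (p i).support} := by
      ext v
      constructor
      · rintro ⟨j, hj, hv⟩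
        rwa [← injective_end hd hj]
      · exact fun hv => ⟨i, rfl, hv⟩
    beta_reduce
    rw [e]
    refine ⟨by simp, (ConnSet.support (p i)).mono_graph hHG, ?_, a i, (hp i).1, by simp⟩
    rw [Set.disjoint_left]
    exact walk_subset_of_closed (p i) (L := Cᶜ) (hCY _ (hp i).1) (fun u v _ _ huv => huv.2.2)
  · rintro x hx x' hx' v ⟨i, rfl, hi⟩ ⟨j, rfl, hj⟩
    rw [hd i j v hi hj]

/-- Restricting a tree decomposition of `G` to a component `C` of `G - X` while pushing `X` along
disjoint connected sets into the bag of the node `s`. -/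
theorem IsTreeDec.restrict [DecidableEq V] {ι : Type} {k : ℕ} {𝔅 : Set (Set V)}
    (h𝔅 : IsBramble G 𝔅) {t : SimpleGraph ι} {bag : ι → Finset V}
    (h : IsTreeDec G Set.univ t bag) {C : Set V} {X : Finset V} (hX : X.card ≤ k)
    (hCX : Disjoint C X) (hbag : ∀ i, Admissible k (insert C 𝔅) (bag i)) {s : ι}
    (hs : Covers (bag s) 𝔅) (hsC : ∀ v ∈ bag s, v ∉ C) {R : V → Set V}
    (hR : ∀ x ∈ X, x ∈ R x ∧ ConnSet G (R x) ∧ Disjoint (R x) C ∧ ∃ y ∈ bag s, y ∈ R x)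
    (hRR : ∀ x ∈ X, ∀ x' ∈ X, ∀ v, v ∈ R x → v ∈ R x' → x = x') :
    ∃ bag' : ι → Finset V, IsTreeDec G (X ∪ C) t bag' ∧ bag' s = X ∧
      ∀ i, Admissible k 𝔅 (bag' i) := by
  classical
  have hnode : ∀ x, ∃ i, x ∈ bag i := fun x => (h.connSet x trivial).nonempty
  choose τ hτ using hnode
  have hpath : ∀ x, ∃ p : t.Walk s (τ x), p.IsPath := fun x =>
    (h.isTree.connected s (τ x)).exists_isPath
  choose p hp using hpath
  have hCX' : ∀ v ∈ C, v ∉ X := fun v hv hv' => Set.disjoint_left.1 hCX hv hv'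
  have hpR : ∀ x ∈ X, ∀ i ∈ (p x).support, ∃ v ∈ R x, v ∈ bag i := by
    intro x hx
    obtain ⟨hxR, hRc, -, y, hy, hyR⟩ := hR x hx
    exact support_subset_of_isTree h.isTree (h.connSet_meeting hRc (Set.subset_univ _))
      ⟨y, hyR, hy⟩ ⟨x, hxR, hτ x⟩ (hp x)
  let bag' : ι → Finset V := fun i =>
    (bag i).filter (fun v => v ∈ (X : Set V) ∪ C) ∪ X.filter (fun x => i ∈ (p x).support)
  have hmem : ∀ i v, v ∈ bag' i ↔ (v ∈ bag i ∧ (v ∈ X ∨ v ∈ C)) ∨ (v ∈ X ∧ i ∈ (p v).support) := by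
    intro i v
    simp [bag']
  refine ⟨bag', ⟨h.isTree, ?_, ?_, ?_⟩, ?_, ?_⟩
  · intro i v hv
    rcases (hmem i v).1 hv with h | h
    · exact h.2
    · exact Or.inl h.1
  · intro u hu v hv huv
    obtain ⟨i, hi⟩ := h.edge u trivial v trivial huv
    exact ⟨i, (hmem i u).2 (Or.inl ⟨hi.1, hu⟩), (hmem i v).2 (Or.inl ⟨hi.2, hv⟩)⟩
  · rintro v (hv | hv)
    · have e : {i | v ∈ bag' i} = {i | v ∈ bag i} ∪ {i | i ∈ (p v).support} := by
        ext i
        have hv' : v ∈ X := hv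
        simp [hmem, hv']
      rw [e]
      exact (h.connSet v trivial).union (ConnSet.support (p v)) ⟨τ v, hτ v, by simp⟩
    · have e : {i | v ∈ bag' i} = {i | v ∈ bag i} := by
        ext i
        simp [hmem, hv, hCX' v hv]
      rw [e]
      exact h.connSet v trivial
  · ext v
    rw [hmem]
    constructor
    · rintro (⟨h1, h2⟩ | h)
      · exact h2.resolve_right (hsC v h1)
      · exact h.1
    · exact fun hv => Or.inr ⟨hv, by simp⟩
  · intro i hi hcov
    let R' : V → Set V := fun x => if x ∈ X then R x else {x}
    have hR' : ∀ w ∈ bag' i, ∃ v ∈ R' w, v ∈ bag i := by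
      intro w hw
      rcases (hmem i w).1 hw with ⟨h1, h2⟩ | ⟨h1, h2⟩
      · refine ⟨w, ?_, h1⟩
        by_cases hwX : w ∈ X
        · simpa [R', hwX] using (hR w hwX).1
        · simp [R', hwX]
      · simpa [R', h1] using hpR w h1 i h2
    choose! f hfR hf using hR'
    have hinj : Set.InjOn f (bag' i) := by
      have hXC : ∀ w ∈ bag' i, w ∉ X → w ∈ C ∧ f w = w := by
        intro w hw hwX
        refine ⟨?_, by simpa [R', hwX] using hfR w hw⟩
        rcases (hmem i w).1 hw with h1 | h1
        · exact h1.2.resolve_left hwX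
        · exact absurd h1.1 hwX
      have hcross : ∀ w ∈ bag' i, ∀ w' ∈ bag' i, w ∈ X → w' ∉ X → f w ≠ f w' := by
        intro w hw w' hw' hX hX' hff
        have h1 := hfR w hw
        simp only [R', hX, if_true] at h1
        rw [hff, (hXC w' hw' hX').2] at h1
        exact Set.disjoint_left.1 (hR w hX).2.2.1 h1 (hXC w' hw' hX').1
      intro w hw w' hw' hff
      by_cases hwX : w ∈ X <;> by_cases hwX' : w' ∈ X
      · have h1 := hfR w hw
        have h2 := hfR w' hw'
        simp only [R', hwX, hwX', if_true] at h1 h2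
        exact hRR w hwX w' hwX' _ h1 (hff ▸ h2)
      · exact (hcross w hw w' hw' hwX hwX' hff).elim
      · exact (hcross w' hw' w hw hwX' hwX hff.symm).elim
      · rw [← (hXC w hw hwX).2, ← (hXC w' hw' hwX').2, hff]
    have hcard : (bag' i).card ≤ (bag i).card :=
      Finset.card_le_card_of_injOn f (fun w hw => hf w hw) hinj
    have hiC : ∃ v ∈ bag i, v ∈ C := by
      by_contra! hcon
      have : bag' i ⊆ X := by
        intro v hv
        rcases (hmem i v).1 hv with h1 | h1
        · exact h1.2.resolve_right (hcon v h1.1)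
        · exact h1.1
      have := Finset.card_le_card this
      omega
    refine hbag i (by omega) ?_
    rintro B (rfl | hB)
    · exact hiC
    · by_contra! hcon
      obtain ⟨w, hw, hwB⟩ := hcov B hB
      obtain ⟨y, hy, hyB⟩ := hs B hB
      rcases (hmem i w).1 hw with h1 | ⟨-, h1⟩
      · exact hcon w h1.1 hwB
      · obtain ⟨v, hvB, hv⟩ := support_subset_of_isTree h.isTree
          (h.connSet_meeting (h𝔅.1 B hB) (Set.subset_univ _)) ⟨y, hyB, hy⟩ ⟨w, hwB, hτ w⟩ (hp w)
          i h1
        exact hcon v hv hvB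

theorem exists_hasTreeDec_admissible [Finite V] (k : ℕ)
    (hcov : ∀ 𝔅, IsBramble G 𝔅 → ∃ X : Finset V, X.card ≤ k ∧ Covers X 𝔅) (𝔅 : Set (Set V))
    (h𝔅 : IsBramble G 𝔅) : ∃ X, HasTreeDec G Set.univ (Admissible k 𝔅) X := by
  classical
  have := Fintype.ofFinite V
  induction hn : 𝔅ᶜ.ncard using Nat.strong_induction_on generalizing 𝔅 with
  | _ n ih =>
  by_contra! hno
  obtain ⟨X, hXcov, hmin⟩ : ∃ X : Finset V, Covers X 𝔅 ∧ ∀ Z, Covers Z 𝔅 → X.card ≤ Z.card := by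
    obtain ⟨X₀, -, hX₀⟩ := hcov 𝔅 h𝔅
    obtain ⟨X, hX, hmin⟩ := Set.exists_min_image {X : Finset V | Covers X 𝔅} Finset.card
      (Set.toFinite _) ⟨X₀, hX₀⟩
    exact ⟨X, hX, hmin⟩
  have hXk : X.card ≤ k := by
    obtain ⟨X₀, hk, hX₀⟩ := hcov 𝔅 h𝔅
    exact (hmin X₀ hX₀).trans hk
  have hXP : Admissible k 𝔅 X := fun h => absurd hXk (by omega)
  have hcomp : ∀ C : Set V, ConnSet G C → Disjoint C X →
      (∀ u ∈ C, ∀ v, G.Adj u v → v ∈ C ∨ v ∈ (X : Set V)) →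
      HasTreeDec G (X ∪ C) (Admissible k 𝔅) X := by
    intro C hCc hCX hC
    by_cases htouch : ∀ B ∈ 𝔅, ConnSet G (C ∪ B)
    · have hC𝔅 : C ∉ 𝔅 := by
        intro hmem
        obtain ⟨x, hx, hxC⟩ := hXcov C hmem
        exact Set.disjoint_left.1 hCX hxC hx
      have hbr : IsBramble G (insert C 𝔅) := by
        refine ⟨?_, ?_⟩
        · rintro B (rfl | hB)
          · exact hCc
          · exact h𝔅.1 B hB
        · rintro B (rfl | hB) B' (rfl | hB')
          · rwa [Set.union_self]
          · exact htouch B' hB'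
          · rw [Set.union_comm]; exact htouch B hB
          · exact h𝔅.2 B hB B' hB'
      have hlt : (insert C 𝔅)ᶜ.ncard < n := by
        rw [← hn]
        refine Set.ncard_lt_ncard ?_ (Set.toFinite _)
        exact compl_lt_compl_iff_lt.2 (Set.ssubset_insert hC𝔅)
      obtain ⟨X', ι, hι, t, bag, r, ht, hr, hbag⟩ := ih _ hlt _ hbr rfl
      obtain ⟨s, hs⟩ : ∃ s, ¬ Admissible k 𝔅 (bag s) := by
        by_contra! hcon
        exact hno X' ⟨ι, hι, t, bag, r, ht, hr, hcon⟩
      simp only [Admissible, not_forall, not_not] at hs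
      obtain ⟨hsk, hscov⟩ := hs
      have hsC : ∀ v ∈ bag s, v ∉ C := by
        by_contra! hcon
        refine hbag s hsk ?_
        rintro B (rfl | hB)
        · exact hcon
        · exact hscov B hB
      obtain ⟨R, hR, hRR⟩ := exists_linkage_avoiding h𝔅 hXcov hmin hC hscov hsC
      obtain ⟨bag', h1, h2, h3⟩ := ht.restrict h𝔅 hXk hCX hbag hscov hsC hR hRR
      exact ⟨ι, hι, t, bag', s, h1, h2, h3⟩
    · push Not at htouch
      obtain ⟨B, hB, hCB⟩ := htouch
      refine hasTreeDec_of_not_touching hXP (Y := Finset.univ.filter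
        fun v => v ∈ C ∨ (v ∈ X ∧ ∃ c ∈ C, G.Adj c v)) ?_ (by simp)
      intro _ hcov
      obtain ⟨v, hv, hvB⟩ := hcov B hB
      rw [Finset.mem_filter] at hv
      rcases hv.2 with hv | ⟨-, c, hc, hcv⟩
      · exact hCB (hCc.union (h𝔅.1 B hB) ⟨v, hv, hvB⟩)
      · exact hCB (hCc.union_of_adj (h𝔅.1 B hB) hc hvB hcv)
  have hall : ∀ F : Finset V, HasTreeDec G (X ∪ reachSet G (X : Set V) F) (Admissible k 𝔅) X := by
    intro F
    induction F using Finset.induction_on with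
    | empty =>
      have : (X : Set V) ∪ reachSet G (X : Set V) (∅ : Finset V) = X := by
        ext v; simp [reachSet]
      rw [this]
      exact hasTreeDec_self hXP
    | insert c F hc ihF =>
      have hun : reachSet G (X : Set V) (insert c F : Finset V) =
          reachSet G (X : Set V) F ∪ reachSet G (X : Set V) {c} := by
        ext v; simp [reachSet, or_comm]
      rw [hun]
      by_cases hcX : c ∈ X
      · have : reachSet G (X : Set V) {c} = ∅ := by
          ext v
          simp only [Set.mem_empty_iff_false, iff_false]
          rintro ⟨a, rfl, p, hp⟩
          exact hp a (by simp) hcX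
        rw [this, Set.union_empty]
        exact ihF
      have hcc := reachSet_singleton_connSet (G := G) (Q := (X : Set V)) (c := c) hcX
      have hdX : Disjoint (reachSet G (X : Set V) {c}) X :=
        Set.disjoint_left.2 fun v hv => notMem_of_mem_reachSet hv
      by_cases hmeet : (reachSet G (X : Set V) {c} ∩ reachSet G (X : Set V) F).Nonempty
      · rw [Set.union_eq_left.2 (hcc.subset_reachSet hdX hmeet)]
        exact ihF
      have hbd : ∀ A : Set V, ∀ u ∈ reachSet G (X : Set V) A, ∀ v, G.Adj u v →
          v ∈ reachSet G (X : Set V) A ∨ v ∈ (X : Set V) := fun A u hu v huv =>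
        (em (v ∈ (X : Set V))).symm.imp_left (reachSet_adj hu huv)
      have := ihF.glue (hcomp _ hcc hdX (hbd _)) (X' := X) ?_ ?_
      · rwa [← Set.union_union_distrib_left] at this
      · rintro v (hv | hv) (hv' | hv')
        · exact ⟨hv, hv⟩
        · exact ⟨hv, hv⟩
        · exact ⟨hv', hv'⟩
        · exact (hmeet ⟨v, hv', hv⟩).elim
      · rintro u (hu | hu) v hv huv
        · exact Or.inl (Or.inl hu)
        · rcases hbd _ u hu v huv with h | h
          · exact Or.inr (Or.inr h)
          · exact Or.inr (Or.inl h)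
  refine hno X ?_
  have := hall Finset.univ
  rwa [show (X : Set V) ∪ reachSet G (X : Set V) (Finset.univ : Finset V) = Set.univ from
    Set.eq_univ_of_forall fun v => (em (v ∈ (X : Set V))).imp_right (subset_reachSet (by simp))]
    at this

/-- The half of treewidth duality that yields a bramble of large order. -/
theorem exists_bramble_of_le_treewidth [Fintype V] {k : ℕ} (hk : 0 < k) (h : k ≤ treewidth G) :
    ∃ 𝔅, IsBramble G 𝔅 ∧ ∀ X : Finset V, Covers X 𝔅 → k < X.card := by
  by_contra! hcon
  obtain ⟨X, ι, hι, t, bag, r, ht, -, hbag⟩ := exists_hasTreeDec_admissible k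
    (fun 𝔅 h𝔅 => (hcon 𝔅 h𝔅).imp fun X hX => hX.symm) ∅ ⟨by simp, by simp⟩
  have hle : treewidth G ≤ k - 1 := Nat.sInf_le ⟨ι, hι, t, bag, ht.isTree,
    fun v => (ht.connSet v trivial).nonempty, fun u v huv => ht.edge u trivial v trivial huv,
    fun v => ht.connSet v trivial, fun i => ?_⟩
  · omega
  · by_contra! hi
    exact hbag i (by omega) (by simp [Covers])

end Bramble

section Growth

variable {V : Type*} {G : SimpleGraph V} {𝔅 : Set (Set V)}

/-- `C` is a component of `G - S` that contains a member of the bramble. -/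
structure IsSide (G : SimpleGraph V) (𝔅 : Set (Set V)) (S : Finset V) (C : Set V) : Prop where
  connSet : ConnSet G C
  disjoint : ∀ u ∈ C, u ∉ S
  boundary : ∀ u ∈ C, ∀ v, G.Adj u v → v ∈ C ∨ v ∈ S
  bramble : ∃ B ∈ 𝔅, B ⊆ C

theorem exists_isSide (h𝔅 : IsBramble G 𝔅) {S : Finset V} (hS : ¬ Covers S 𝔅) :
    ∃ C, IsSide G 𝔅 S C := by
  simp only [Covers, not_forall, not_exists, not_and] at hS
  obtain ⟨B, hB, hBS⟩ := hS
  obtain ⟨c, hc⟩ := (h𝔅.1 B hB).nonempty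
  have hcS : c ∉ (S : Set V) := fun h => hBS c h hc
  refine ⟨reachSet G (S : Set V) {c}, reachSet_singleton_connSet hcS,
    fun u hu => notMem_of_mem_reachSet hu, fun u hu v huv => ?_, B, hB, ?_⟩
  · exact (em (v ∈ S)).symm.imp_left (reachSet_adj hu huv)
  · exact (h𝔅.1 B hB).subset_reachSet (Set.disjoint_left.2 fun x hx hxS => hBS x hxS hx)
      ⟨c, hc, subset_reachSet rfl hcS⟩

theorem IsSide.subset_of_connSet (h𝔅 : IsBramble G 𝔅) {S : Finset V} {C R : Set V}
    (h : IsSide G 𝔅 S C) (hR : ConnSet G R) (hRS : ∀ u ∈ R, u ∉ S) (hRB : ∃ B ∈ 𝔅, B ⊆ R) :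
    R ⊆ C := by
  obtain ⟨B, hB, hBC⟩ := h.bramble
  obtain ⟨B', hB', hBR⟩ := hRB
  obtain ⟨x, hx⟩ := (h𝔅.1 B hB).nonempty
  obtain ⟨y, hy⟩ := (h𝔅.1 B' hB').nonempty
  have hsub : B ∪ B' ⊆ C := (h𝔅.2 B hB B' hB').subset_of_boundary (S := (S : Set V))
    (Set.disjoint_left.2 fun u hu => hu.elim (fun h' => h.disjoint u (hBC h'))
      fun h' => hRS u (hBR h')) h.boundary ⟨x, Or.inl hx, hBC hx⟩
  exact hR.subset_of_boundary (S := (S : Set V)) (Set.disjoint_left.2 hRS) h.boundary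
    ⟨y, hBR hy, hsub (Or.inr hy)⟩

theorem IsSide.subset (h𝔅 : IsBramble G 𝔅) {S S' : Finset V} {C C' : Set V}
    (h : IsSide G 𝔅 S C) (h' : IsSide G 𝔅 S' C') (hS : S ⊆ S') : C' ⊆ C :=
  h.subset_of_connSet h𝔅 h'.connSet (fun u hu huS => h'.disjoint u hu (hS huS)) h'.bramble

/-- In a tight side every boundary vertex is needed. -/
theorem exists_adj_of_tight {S : Finset V} {C : Set V} (h : IsSide G 𝔅 S C)
    (htight : ∀ S' C', IsSide G 𝔅 S' C' → C' ⊆ C → S.card ≤ S'.card) {s : V} (hs : s ∈ S) :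
    ∃ u ∈ C, G.Adj s u := by
  classical
  by_contra! hcon
  have := htight (S.erase s) C ⟨h.connSet,
    fun u hu hS => h.disjoint u hu (Finset.mem_of_mem_erase hS), fun u hu x hux => ?_,
    h.bramble⟩ subset_rfl
  · have := Finset.card_erase_lt_of_mem hs
    omega
  · refine (h.boundary u hu x hux).imp_right fun hx => Finset.mem_erase.2 ⟨?_, hx⟩
    rintro rfl
    exact hcon u hu hux.symm

/-- The graph obtained from `G` by keeping only the edges inside `A`. -/
def restrictEdges (G : SimpleGraph V) (A : Set V) : SimpleGraph V where
  Adj u v := G.Adj u v ∧ u ∈ A ∧ v ∈ A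
  symm := ⟨fun _ _ h => ⟨h.1.symm, h.2.2, h.2.1⟩⟩
  loopless := ⟨fun u h => G.loopless.irrefl u h.1⟩

theorem restrictEdges_le (A : Set V) : restrictEdges G A ≤ G := fun _ _ h => h.1

theorem support_restrictEdges {A : Set V} {a b : V} (p : (restrictEdges G A).Walk a b)
    (ha : a ∈ A) : ∀ x ∈ p.support, x ∈ A :=
  walk_subset_of_closed p ha fun _ _ _ _ huv => huv.2.2

/-- Two nested tight sides of the same order are linked. -/
theorem linked_of_tight [Finite V] (h𝔅 : IsBramble G 𝔅) {k : ℕ}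
    (hk : ∀ X : Finset V, Covers X 𝔅 → k < X.card) {S S' : Finset V} {C C' : Set V}
    (h : IsSide G 𝔅 S C) (h' : IsSide G 𝔅 S' C') (hCC : C' ⊆ C) (hS : S.card ≤ k)
    (htight : ∀ S' C', IsSide G 𝔅 S' C' → C' ⊆ C → S.card ≤ S'.card) :
    Linked (restrictEdges G ((C ∪ S) \ C')) S S' S.card := by
  classical
  refine menger _ _ _ _ fun Q hQ => ?_
  set H := restrictEdges G ((C ∪ S) \ C')
  by_contra! hQw
  set Q' := Q.filter (· ∉ C')
  have hQ'Q : Q'.card ≤ Q.card := Finset.card_filter_le _ _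
  have hS0 : ∀ s ∈ S, s ∈ (C ∪ S) \ C' := fun s hs =>
    ⟨Or.inr hs, fun hC => h.disjoint s (hCC hC) hs⟩
  set K := reachSet H (Q' : Set V) S
  have hKA : ∀ x ∈ K, x ∈ (C ∪ S) \ C' := by
    rintro x ⟨a, ha, p, -⟩
    exact support_restrictEdges p (hS0 a ha) x (by simp)
  have hKS' : ∀ x ∈ K, x ∉ S' := by
    rintro x ⟨a, ha, p, hp⟩ hx
    obtain ⟨q, hq, hqp⟩ := hQ a ha x hx p
    exact hp q hqp (Finset.mem_filter.2 ⟨hq, (support_restrictEdges p (hS0 a ha) q hqp).2⟩)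
  obtain ⟨D, hD⟩ := exists_isSide h𝔅 (S := Q') fun hc => by
    have := hk Q' hc
    omega
  have hC'D : C' ⊆ D := hD.subset_of_connSet h𝔅 h'.connSet
    (fun u hu hQ => (Finset.mem_filter.1 hQ).2 hu) h'.bramble
  obtain ⟨c, hc⟩ := h'.connSet.nonempty
  have hDL : D ⊆ {x | x ∈ C ∧ x ∉ K} := by
    refine hD.connSet.subset_of_closed ⟨c, hC'D hc, hCC hc, fun hcK => (hKA c hcK).2 hc⟩ ?_
    rintro u x hu ⟨huC, huK⟩ hx hux
    have hxK : x ∉ K := by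
      intro hxK
      by_cases huC' : u ∈ C'
      · exact (h'.boundary u huC' x hux).elim (hKA x hxK).2 (hKS' x hxK)
      · exact huK (reachSet_adj hxK (show H.Adj x u from ⟨hux.symm, hKA x hxK, Or.inl huC, huC'⟩)
          (hD.disjoint u hu))
    exact ⟨(h.boundary u huC x hux).resolve_right fun hxS =>
      hxK (subset_reachSet hxS (hD.disjoint x hx)), hxK⟩
  have := htight Q' D hD fun x hx => (hDL hx).1
  omega

/-- A minor model of a rooted forest on `w` nodes, with parent function `par`, whose `i`-th branch
set contains the vertex `v i`, where `C` is a side of the set of these vertices and no smaller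
set has a side inside `C`. -/
structure IsRooted (G : SimpleGraph V) [DecidableEq V] (𝔅 : Set (Set V)) (par : ℕ → ℕ) (w : ℕ)
    (M : ℕ → Set V) (v : ℕ → V) (C : Set V) : Prop where
  mem : ∀ i < w, v i ∈ M i
  connSet : ∀ i < w, ConnSet G (M i)
  disjoint : ∀ i < w, ∀ j < w, ∀ x, x ∈ M i → x ∈ M j → i = j
  avoid : ∀ i < w, ∀ x ∈ M i, x ∉ C
  side : IsSide G 𝔅 ((Finset.range w).image v) C
  tight : ∀ S' C', IsSide G 𝔅 S' C' → C' ⊆ C → w ≤ S'.card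
  adj : ∀ i < w, par i < i → ∃ a ∈ M i, ∃ b ∈ M (par i), G.Adj a b

variable [DecidableEq V] {par : ℕ → ℕ} {w : ℕ} {M : ℕ → Set V} {v : ℕ → V} {C : Set V}

theorem IsRooted.injOn (h : IsRooted G 𝔅 par w M v C) :
    ∀ i < w, ∀ j < w, v i = v j → i = j := fun i hi j hj hij =>
  h.disjoint i hi j hj (v i) (h.mem i hi) (hij ▸ h.mem j hj)

theorem IsRooted.card (h : IsRooted G 𝔅 par w M v C) :
    ((Finset.range w).image v).card = w := by
  rw [Finset.card_image_of_injOn, Finset.card_range]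
  intro i hi j hj hij
  exact h.injOn i (by simpa using hi) j (by simpa using hj) hij

theorem IsRooted.push [Finite V] (h𝔅 : IsBramble G 𝔅) {k : ℕ}
    (hk : ∀ X : Finset V, Covers X 𝔅 → k < X.card) (h : IsRooted G 𝔅 par w M v C) (hw : w ≤ k)
    {S' : Finset V} {C' : Set V} (h' : IsSide G 𝔅 S' C') (hCC : C' ⊆ C) (hS' : S'.card = w) :
    ∃ M' v', IsRooted G 𝔅 par w M' v' C' := by
  have hcard := h.card
  obtain rfl | hw0 := Nat.eq_zero_or_pos w
  · rw [Finset.card_eq_zero] at hS'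
    exact ⟨M, v, by simp, by simp, by simp, by simp, by simpa [hS'] using h', by simp, by simp⟩
  have := Fin.pos_iff_nonempty.1 hw0
  set S := (Finset.range w).image v
  have hL := linked_of_tight (S := S) h𝔅 hk h.side h' hCC (by rwa [hcard])
    (by rw [hcard]; exact h.tight)
  rw [hcard] at hL
  obtain ⟨a, b, p, hp, hd⟩ := hL
  have hS0 : ∀ s ∈ S, s ∈ (C ∪ S) \ C' := fun s hs =>
    ⟨Or.inr hs, fun hC => h.side.disjoint s (hCC hC) hs⟩
  have hsup : ∀ i, ∀ x ∈ (p i).support, x ∈ (C ∪ S) \ C' := fun i =>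
    support_restrictEdges (p i) (hS0 _ (hp i).1)
  have hvS : ∀ i < w, v i ∈ S := fun i hi => Finset.mem_image_of_mem v (Finset.mem_range.2 hi)
  have hsurj : ∀ i < w, ∃ j : Fin w, a j = v i := fun i hi =>
    exists_apply_eq (injective_start hd) (fun i => (hp i).1) hcard.le _ (hvS i hi)
  choose! j hj using hsurj
  have hjinj : ∀ i < w, ∀ i' < w, j i = j i' → i = i' := fun i hi i' hi' hii =>
    h.injOn i hi i' hi' (by rw [← hj i hi, ← hj i' hi', hii])
  have hcross : ∀ i < w, ∀ i' < w, ∀ x, x ∈ M i → x ∈ (p (j i')).support → i = i' := by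
    intro i hi i' hi' x hx hx'
    have hxS : x ∈ S := (hsup _ x hx').1.resolve_left (h.avoid i hi x hx)
    obtain ⟨i₁, hi₁, rfl⟩ := Finset.mem_image.1 hxS
    rw [Finset.mem_range] at hi₁
    obtain rfl := h.disjoint i₁ hi₁ i hi _ (h.mem i₁ hi₁) hx
    refine hjinj _ hi _ hi' (hd _ _ (v i₁) ?_ hx')
    rw [← hj i₁ hi]
    simp
  refine ⟨fun i => M i ∪ {x | x ∈ (p (j i)).support}, fun i => b (j i), ?_, ?_, ?_, ?_, ?_, ?_, ?_⟩
  · exact fun i hi => Or.inr (by simp)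
  · intro i hi
    refine (h.connSet i hi).union ((ConnSet.support (p (j i))).mono_graph (restrictEdges_le _))
      ⟨v i, h.mem i hi, ?_⟩
    rw [← hj i hi]
    simp
  · rintro i hi i' hi' x (hx | hx) (hx' | hx')
    · exact h.disjoint i hi i' hi' x hx hx'
    · exact hcross i hi i' hi' x hx hx'
    · exact (hcross i' hi' i hi x hx' hx).symm
    · exact hjinj i hi i' hi' (hd _ _ x hx hx')
  · rintro i hi x (hx | hx)
    · exact fun hC => h.avoid i hi x hx (hCC hC)
    · exact (hsup _ x hx).2
  · convert h'
    refine Finset.eq_of_subset_of_card_le (fun s hs => ?_) ?_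
    · obtain ⟨i, -, rfl⟩ := Finset.mem_image.1 hs
      exact (hp _).2.1
    · rw [hS', Finset.card_image_of_injOn, Finset.card_range]
      intro i hi i' hi' hii
      exact hjinj i (by simpa using hi) i' (by simpa using hi') (injective_end hd hii)
  · exact fun S'' C'' hs hC => h.tight S'' C'' hs (hC.trans hCC)
  · intro i hi hpi
    obtain ⟨x, hx, y, hy, hxy⟩ := h.adj i hi hpi
    exact ⟨x, Or.inl hx, y, Or.inl hy, hxy⟩

theorem IsRooted.grow [Finite V] (h𝔅 : IsBramble G 𝔅) {k : ℕ}
    (hk : ∀ X : Finset V, Covers X 𝔅 → k < X.card) (h : IsRooted G 𝔅 par w M v C) (hw : w < k) :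
    ∃ M' v' C', IsRooted G 𝔅 par (w + 1) M' v' C' := by
  induction hn : C.ncard using Nat.strong_induction_on generalizing C M v with
  | _ n ih =>
  obtain ⟨u, huC, hu⟩ : ∃ u ∈ C, par w < w → G.Adj u (v (par w)) := by
    by_cases hpw : par w < w
    · obtain ⟨u, hu, huv⟩ := exists_adj_of_tight h.side (by rw [h.card]; exact h.tight)
        (Finset.mem_image_of_mem v (Finset.mem_range.2 hpw))
      exact ⟨u, hu, fun _ => huv.symm⟩
    · obtain ⟨u, hu⟩ := h.side.connSet.nonempty
      exact ⟨u, hu, fun h => absurd h hpw⟩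
  let v₁ := Function.update v w u
  let M₁ := Function.update M w {u}
  have hv₁ : ∀ i < w, v₁ i = v i := fun i hi => Function.update_of_ne (by omega) _ _
  have hM₁ : ∀ i < w, M₁ i = M i := fun i hi => Function.update_of_ne (by omega) _ _
  have hv₁w : v₁ w = u := Function.update_self _ _ _
  have hM₁w : M₁ w = {u} := Function.update_self _ _ _
  have himg : (Finset.range (w + 1)).image v₁ = insert u ((Finset.range w).image v) := by
    rw [Finset.range_add_one, Finset.image_insert, hv₁w]
    congr 1
    exact Finset.image_congr fun i hi => hv₁ i (by simpa using hi)
  obtain ⟨C₁, hC₁⟩ := exists_isSide h𝔅 (S := insert u ((Finset.range w).image v)) fun hc => by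
    have h1 := hk _ hc
    have h2 := Finset.card_insert_le u ((Finset.range w).image v)
    have h3 := h.card
    omega
  have hCC := h.side.subset h𝔅 hC₁ (Finset.subset_insert _ _)
  have huC₁ : u ∉ C₁ := fun hu => hC₁.disjoint u hu (Finset.mem_insert_self _ _)
  by_cases htight : ∀ S' C', IsSide G 𝔅 S' C' → C' ⊆ C₁ → w + 1 ≤ S'.card
  · have huM : ∀ i < w, u ∉ M i := fun i hi hui => h.avoid i hi u hui huC
    refine ⟨M₁, v₁, C₁, ?_, ?_, ?_, ?_, himg ▸ hC₁, htight, ?_⟩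
    · intro i hi
      rcases Nat.lt_succ_iff_lt_or_eq.1 hi with hi | rfl
      · rw [hM₁ i hi, hv₁ i hi]; exact h.mem i hi
      · rw [hM₁w, hv₁w]; rfl
    · intro i hi
      rcases Nat.lt_succ_iff_lt_or_eq.1 hi with hi | rfl
      · rw [hM₁ i hi]; exact h.connSet i hi
      · rw [hM₁w]; exact ConnSet.singleton u
    · intro i hi j hj x hx hx'
      rcases Nat.lt_succ_iff_lt_or_eq.1 hi with hi | rfl <;>
        rcases Nat.lt_succ_iff_lt_or_eq.1 hj with hj | rfl
      · rw [hM₁ i hi] at hx; rw [hM₁ j hj] at hx'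
        exact h.disjoint i hi j hj x hx hx'
      · rw [hM₁ i hi] at hx; rw [hM₁w] at hx'
        exact (huM i hi (hx' ▸ hx)).elim
      · rw [hM₁w] at hx; rw [hM₁ j hj] at hx'
        exact (huM j hj (hx ▸ hx')).elim
      · rfl
    · intro i hi x hx
      rcases Nat.lt_succ_iff_lt_or_eq.1 hi with hi | rfl
      · rw [hM₁ i hi] at hx
        exact fun hxC => h.avoid i hi x hx (hCC hxC)
      · rw [hM₁w] at hx
        exact hx ▸ huC₁
    · intro i hi hpi
      rcases Nat.lt_succ_iff_lt_or_eq.1 hi with hi | rfl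
      · rw [hM₁ i hi, hM₁ _ (by omega)]
        exact h.adj i hi hpi
      · rw [hM₁w, hM₁ _ hpi]
        exact ⟨u, rfl, v (par i), h.mem _ hpi, hu hpi⟩
  · push Not at htight
    obtain ⟨S', C', hS', hC', hcard⟩ := htight
    have hwS' := h.tight S' C' hS' (hC'.trans hCC)
    obtain ⟨M', v', h'⟩ := h.push h𝔅 hk hw.le hS' (hC'.trans hCC) (by omega)
    refine ih _ ?_ h' rfl
    rw [← hn]
    exact Set.ncard_lt_ncard ⟨hC'.trans hCC, fun hsub => huC₁ (hC' (hsub huC))⟩ (Set.toFinite _)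

theorem exists_isRooted [Finite V] (h𝔅 : IsBramble G 𝔅) {k : ℕ}
    (hk : ∀ X : Finset V, Covers X 𝔅 → k < X.card) (par : ℕ → ℕ) (hw : w ≤ k) :
    ∃ M v C, IsRooted G 𝔅 par w M v C := by
  induction w with
  | zero =>
    obtain ⟨C, hC⟩ := exists_isSide h𝔅 (S := ∅) fun hc => by simpa using hk ∅ hc
    obtain ⟨c, -⟩ := hC.connSet.nonempty
    exact ⟨fun _ => ∅, fun _ => c, C, by simp, by simp, by simp, by simp, by simpa using hC,
      by simp, by simp⟩
  | succ w ih =>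
    obtain ⟨M, v, C, h⟩ := ih (by omega)
    exact h.grow h𝔅 hk (by omega)

end Growth

section Linkage

variable {V : Type*} {G : SimpleGraph V} {𝔅 : Set (Set V)}

/-- The graph on the index set of a family of vertex sets that joins adjacent members. -/
def touchGraph {ι : Type*} (G : SimpleGraph V) (D : ι → Set V) : SimpleGraph ι where
  Adj i j := i ≠ j ∧ ∃ a ∈ D i, ∃ b ∈ D j, G.Adj a b
  symm := ⟨fun _ _ ⟨h, a, ha, b, hb, hab⟩ => ⟨h.symm, b, hb, a, ha, hab.symm⟩⟩
  loopless := ⟨fun _ h => h.1 rfl⟩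

theorem touchGraph_connected {ι : Type*} [Nonempty ι] {D : ι → Set V}
    (hne : ∀ i, (D i).Nonempty) (hd : ∀ i j x, x ∈ D i → x ∈ D j → i = j)
    (hC : ConnSet G {x | ∃ i, x ∈ D i}) : (touchGraph G D).Connected := by
  refine ⟨fun i j => ?_⟩
  have hsub : {x | ∃ i, x ∈ D i} ⊆ {x | ∃ j, (touchGraph G D).Reachable i j ∧ x ∈ D j} := by
    refine hC.subset_of_closed ?_ ?_
    · obtain ⟨x, hx⟩ := hne i
      exact ⟨x, ⟨i, hx⟩, i, Reachable.refl i, hx⟩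
    · rintro u x - ⟨j, hij, hu⟩ ⟨j', hx⟩ hux
      refine ⟨j', ?_, hx⟩
      by_cases hjj : j = j'
      · exact hjj ▸ hij
      · exact hij.trans (Adj.reachable ⟨hjj, u, hu, x, hx, hux⟩)
  obtain ⟨x, hx⟩ := hne j
  obtain ⟨j', hij, hx'⟩ := hsub ⟨j, hx⟩
  exact hd j' j x hx' hx ▸ hij

/-- Disjoint connected subsets of a connected set extend to a partition into connected sets. -/
theorem exists_connSet_partition [Finite V] {ι : Type*} [Nonempty ι] {C : Set V}
    (hC : ConnSet G C) (D : ι → Set V) (hDc : ∀ i, ConnSet G (D i)) (hDC : ∀ i, D i ⊆ C)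
    (hd : ∀ i j x, x ∈ D i → x ∈ D j → i = j) :
    ∃ D' : ι → Set V, (∀ i, D i ⊆ D' i) ∧ (∀ i, ConnSet G (D' i)) ∧ {x | ∃ i, x ∈ D' i} = C ∧
      ∀ i j x, x ∈ D' i → x ∈ D' j → i = j := by
  classical
  induction hn : (C \ {x | ∃ i, x ∈ D i}).ncard using Nat.strong_induction_on generalizing D with
  | _ n ih =>
  by_cases hcl : ∀ u x, u ∈ C → u ∈ {x | ∃ i, x ∈ D i} → x ∈ C → G.Adj u x →
      x ∈ {x | ∃ i, x ∈ D i}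
  · refine ⟨D, fun i => subset_rfl, hDc, ?_, hd⟩
    obtain ⟨i⟩ := ‹Nonempty ι›
    obtain ⟨x, hx⟩ := (hDc i).nonempty
    exact Set.Subset.antisymm (fun y ⟨j, hy⟩ => hDC j hy)
      (hC.subset_of_closed ⟨x, hDC i hx, i, hx⟩ hcl)
  · push Not at hcl
    obtain ⟨u, x, -, ⟨i, hui⟩, hxC, hux, hx⟩ := hcl
    have hxD : ∀ j, x ∉ D j := fun j hj => hx ⟨j, hj⟩
    have hmem : ∀ j y, y ∈ Function.update D i (insert x (D i)) j ↔
        y ∈ D j ∨ (j = i ∧ y = x) := by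
      intro j y
      by_cases hj : j = i
      · subst hj
        simp [or_comm]
      · simp [hj]
    suffices ∃ D' : ι → Set V, (∀ j, Function.update D i (insert x (D i)) j ⊆ D' j) ∧
        (∀ i, ConnSet G (D' i)) ∧ {x | ∃ i, x ∈ D' i} = C ∧
        ∀ i j x, x ∈ D' i → x ∈ D' j → i = j by
      obtain ⟨D', h1, h2, h3, h4⟩ := this
      exact ⟨D', fun j y hy => h1 j ((hmem j y).2 (Or.inl hy)), h2, h3, h4⟩
    refine ih _ ?_ (Function.update D i (insert x (D i))) ?_ ?_ ?_ rfl
    · rw [← hn]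
      refine Set.ncard_lt_ncard ⟨fun y hy => ⟨hy.1, fun ⟨j, hj⟩ => hy.2 ⟨j, ?_⟩⟩, fun hsub => ?_⟩
        (Set.toFinite _)
      · exact (hmem j y).2 (Or.inl hj)
      · exact (hsub ⟨hxC, hx⟩).2 ⟨i, (hmem i x).2 (Or.inr ⟨rfl, rfl⟩)⟩
    · intro j
      by_cases hj : j = i
      · subst hj
        rw [Function.update_self, Set.insert_eq]
        exact (ConnSet.singleton x).union_of_adj (hDc j) rfl hui hux.symm
      · rw [Function.update_of_ne hj]
        exact hDc j
    · intro j y hy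
      rcases (hmem j y).1 hy with h | ⟨-, rfl⟩
      · exact hDC j h
      · exact hxC
    · intro j j' y hy hy'
      rcases (hmem j y).1 hy with h | ⟨rfl, rfl⟩ <;> rcases (hmem j' y).1 hy' with h' | ⟨rfl, h'⟩
      · exact hd j j' y h h'
      · exact (hxD j (h' ▸ h)).elim
      · exact (hxD _ h').elim
      · rfl

/-- The interior of a path whose ends are not adjacent. -/
theorem exists_connSet_interior {a b : V} {p : G.Walk a b} (hp : p.IsPath) (hab : a ≠ b)
    (hadj : ¬ G.Adj a b) : ∃ D : Set V, ConnSet G D ∧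
      (∀ x ∈ D, x ∈ p.support ∧ x ≠ a ∧ x ≠ b) ∧ (∃ u ∈ D, G.Adj a u) ∧ ∃ u ∈ D, G.Adj b u := by
  cases p with
  | nil => exact (hab rfl).elim
  | @cons _ c _ h q =>
    rw [Walk.cons_isPath_iff] at hp
    have hq : q.reverse.IsPath := hp.1.reverse
    have hs : ∀ x, x ∈ q.reverse.support ↔ x ∈ q.support := by simp
    cases hqr : q.reverse with
    | nil => exact (hadj h).elim
    | @cons _ d _ h' q' =>
      rw [hqr] at hq hs
      rw [Walk.cons_isPath_iff] at hq
      refine ⟨{x | x ∈ q'.support}, ConnSet.support q', fun x hx => ?_, ⟨c, by simp, h⟩,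
        ⟨d, by simp, h'⟩⟩
      have hxq : x ∈ q.support := (hs x).1 (by
          rw [Walk.support_cons]; exact List.mem_cons_of_mem _ hx)
      refine ⟨by rw [Walk.support_cons]; exact List.mem_cons_of_mem _ hxq, ?_, ?_⟩
      · rintro rfl; exact hp.2 hxq
      · rintro rfl; exact hq.2 hx

/-- The graph formed by the edges of `G` inside `A` that have an end in `C`. -/
def edgesMeeting (G : SimpleGraph V) (A C : Set V) : SimpleGraph V where
  Adj u v := (G.Adj u v ∧ u ∈ A ∧ v ∈ A) ∧ (u ∈ C ∨ v ∈ C)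
  symm := ⟨fun _ _ h => ⟨⟨h.1.1.symm, h.1.2.2, h.1.2.1⟩, h.2.symm⟩⟩
  loopless := ⟨fun u h => G.loopless.irrefl u h.1.1⟩

theorem linked_edgesMeeting [Finite V] (h𝔅 : IsBramble G 𝔅) {k m : ℕ}
    (hk : ∀ X : Finset V, Covers X 𝔅 → k < X.card) {S : Finset V} {C : Set V}
    (h : IsSide G 𝔅 S C)
    (htight : ∀ S' C', IsSide G 𝔅 S' C' → C' ⊆ C → S.card ≤ S'.card) {X Y : Finset V}
    (hX : X ⊆ S) (hY : Y ⊆ S) (hXm : X.card = m) (hYm : Y.card = m) (hmk : S.card + m ≤ k + 1) :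
    Linked (edgesMeeting G (C ∪ X ∪ Y) C) X Y m := by
  classical
  refine menger _ _ _ _ fun Q hQ => ?_
  set H := edgesMeeting G (C ∪ X ∪ Y) C
  by_contra! hQm
  obtain ⟨D, hD⟩ := exists_isSide h𝔅 (S := S ∪ Q) fun hc => by
    have h1 := hk _ hc
    have h2 := Finset.card_union_le S Q
    omega
  have hDC : D ⊆ C := h.subset h𝔅 hD Finset.subset_union_left
  have hDQ : ∀ x ∈ D, x ∉ (Q : Set V) := fun x hx hxQ =>
    hD.disjoint x hx (Finset.mem_union_right _ hxQ)
  have hsmall : ∀ Z : Finset V, Z ⊆ S → Z.card = m →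
      ∃ z ∈ Z, z ∉ Q ∧ ∃ c ∈ D, G.Adj c z := by
    intro Z hZ hZm
    by_contra! hcon
    have := htight (S \ Z ∪ Q) D ⟨hD.connSet, fun u hu huS => hD.disjoint u hu ?_,
      fun u hu x hux => ?_, hD.bramble⟩ hDC
    · have h1 := Finset.card_union_le (S \ Z) Q
      have h2 := Finset.card_sdiff_of_subset hZ
      have h3 := Finset.card_le_card hZ
      omega
    · exact Finset.union_subset_union_left Finset.sdiff_subset huS
    · refine (hD.boundary u hu x hux).imp_right fun hx => ?_
      rw [Finset.mem_union, Finset.mem_sdiff]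
      by_cases hxQ : x ∈ Q
      · exact Or.inr hxQ
      · refine Or.inl ⟨(Finset.mem_union.1 hx).resolve_right hxQ, fun hxZ => ?_⟩
        exact hcon x hxZ hxQ u hu hux
  obtain ⟨x, hx, hxQ, c, hc, hcx⟩ := hsmall X hX hXm
  obtain ⟨y, hy, hyQ, d, hd, hdy⟩ := hsmall Y hY hYm
  have hxK : x ∈ reachSet H (Q : Set V) X := subset_reachSet hx hxQ
  have hcK : c ∈ reachSet H (Q : Set V) X := reachSet_adj hxK
    (show H.Adj x c from ⟨⟨hcx.symm, Or.inl (Or.inr hx), Or.inl (Or.inl (hDC hc))⟩,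
      Or.inr (hDC hc)⟩) (hDQ c hc)
  have hDK : D ⊆ reachSet H (Q : Set V) X :=
    hD.connSet.subset_of_closed ⟨c, hc, hcK⟩ fun u v hu huK hv huv => reachSet_adj huK
      (show H.Adj u v from ⟨⟨huv, Or.inl (Or.inl (hDC hu)), Or.inl (Or.inl (hDC hv))⟩,
        Or.inl (hDC hu)⟩) (hDQ v hv)
  obtain ⟨a, ha, p, hp⟩ := reachSet_adj (hDK hd)
    (show H.Adj d y from ⟨⟨hdy, Or.inl (Or.inl (hDC hd)), Or.inr hy⟩, Or.inl (hDC hd)⟩) hyQ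
  obtain ⟨q, hq, hqp⟩ := hQ a ha y hy p
  exact hp q hqp hq

/-- A tight side can be partitioned into connected sets that pair up given boundary vertices. -/
theorem exists_linkage_partition [Finite V] (h𝔅 : IsBramble G 𝔅) {k m : ℕ}
    (hk : ∀ X : Finset V, Covers X 𝔅 → k < X.card) {S : Finset V} {C : Set V}
    (h : IsSide G 𝔅 S C)
    (htight : ∀ S' C', IsSide G 𝔅 S' C' → C' ⊆ C → S.card ≤ S'.card) {x : Fin m → V}
    {Y : Finset V} (hm : 0 < m) (hx : ∀ i, x i ∈ S) (hxinj : Function.Injective x) (hY : Y ⊆ S)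
    (hYm : Y.card = m) (hxY : ∀ i, x i ∉ Y) (hmk : S.card + m ≤ k + 1) :
    ∃ (D : Fin m → Set V) (y : Fin m → V), (∀ i, ConnSet G (D i)) ∧ (∀ i, D i ⊆ C) ∧
      (∀ i j u, u ∈ D i → u ∈ D j → i = j) ∧ (touchGraph G D).Connected ∧
      (∀ i, ∃ u ∈ D i, G.Adj (x i) u) ∧ (∀ i, ∃ u ∈ D i, G.Adj (y i) u) ∧
      (∀ i, y i ∈ Y) ∧ Function.Injective y := by
  classical
  have : Nonempty (Fin m) := ⟨⟨0, hm⟩⟩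
  set X := Finset.univ.image x
  have hXm : X.card = m := by
    rw [Finset.card_image_of_injective _ hxinj, Finset.card_univ, Fintype.card_fin]
  have hXS : X ⊆ S := by
    intro z hz
    obtain ⟨i, -, rfl⟩ := Finset.mem_image.1 hz
    exact hx i
  obtain ⟨a, b, p, hp, hd⟩ := linked_edgesMeeting h𝔅 hk h htight hXS hY hXm hYm hmk
  have hXY : ∀ z ∈ X, z ∉ Y := by
    intro z hz
    obtain ⟨i, -, rfl⟩ := Finset.mem_image.1 hz
    exact hxY i
  have hXC : ∀ z ∈ X, z ∉ C := fun z hz hC => h.disjoint z hC (hXS hz)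
  have hYC : ∀ z ∈ Y, z ∉ C := fun z hz hC => h.disjoint z hC (hY hz)
  have hint : ∀ i, ∃ D : Set V, ConnSet G D ∧ (∀ z ∈ D, z ∈ (p i).support ∧ z ∈ C) ∧
      (∃ u ∈ D, G.Adj (a i) u) ∧ ∃ u ∈ D, G.Adj (b i) u := by
    intro i
    have hle : edgesMeeting G (C ∪ X ∪ Y) C ≤ G := fun u v huv => huv.1.1
    obtain ⟨D, hDc, hD, ⟨u, hu, hau⟩, ⟨u', hu', hbu⟩⟩ := exists_connSet_interior (hp i).2.2
      (fun hab => hXY _ (hp i).1 (hab ▸ (hp i).2.1))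
      (fun hab => hab.2.elim (hXC _ (hp i).1) (hYC _ (hp i).2.1))
    refine ⟨D, hDc.mono_graph hle, fun z hz => ⟨(hD z hz).1, ?_⟩, ⟨u, hu, hle hau⟩,
      ⟨u', hu', hle hbu⟩⟩
    obtain ⟨hzp, hza, hzb⟩ := hD z hz
    have hzA := walk_subset_of_closed (p i) (L := C ∪ X ∪ Y) (Or.inl (Or.inr (hp i).1))
      (fun u v _ _ huv => huv.1.2.2) z hzp
    rcases hzA with (hz | hz) | hz
    · exact hz
    · obtain ⟨j, rfl⟩ := exists_apply_eq (injective_start hd) (fun i => (hp i).1) hXm.le z hz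
      exact (hza (by rw [hd i j _ hzp (by simp)])).elim
    · obtain ⟨j, rfl⟩ := exists_apply_eq (injective_end hd) (fun i => (hp i).2.1) hYm.le z hz
      exact (hzb (by rw [hd i j _ hzp (by simp)])).elim
  choose D hDc hD hDa hDb using hint
  have he : ∀ i, ∃ j, a j = x i := fun i =>
    exists_apply_eq (injective_start hd) (fun i => (hp i).1) hXm.le _
      (Finset.mem_image_of_mem x (Finset.mem_univ i))
  choose e he using he
  have heinj : Function.Injective e := fun i j hij => hxinj (by rw [← he i, ← he j, hij])
  obtain ⟨D', h1, h2, h3, h4⟩ := exists_connSet_partition h.connSet (fun i => D (e i))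
    (fun i => hDc _) (fun i z hz => (hD _ z hz).2)
    (fun i j z hz hz' => heinj (hd _ _ z (hD _ z hz).1 (hD _ z hz').1))
  refine ⟨D', fun i => b (e i), h2, fun i z hz => h3 ▸ ⟨i, hz⟩, h4,
    touchGraph_connected (fun i => (h2 i).nonempty) h4 (h3.symm ▸ h.connSet), fun i => ?_,
    fun i => ?_, fun i => (hp _).2.1, (injective_end hd).comp heinj⟩
  · obtain ⟨u, hu, hau⟩ := hDa (e i)
    exact ⟨u, h1 i hu, he i ▸ hau⟩
  · obtain ⟨u, hu, hbu⟩ := hDb (e i)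
    exact ⟨u, h1 i hu, hbu⟩

end Linkage

section Assembly

variable {V : Type*} {G : SimpleGraph V}

/-- There is an edge between `A` and `B`. -/
def Touch (G : SimpleGraph V) (A B : Set V) : Prop := ∃ a ∈ A, ∃ b ∈ B, G.Adj a b

theorem Touch.symm {A B : Set V} (h : Touch G A B) : Touch G B A := by
  obtain ⟨a, ha, b, hb, hab⟩ := h
  exact ⟨b, hb, a, ha, hab.symm⟩

theorem Touch.mono {A B A' B' : Set V} (h : Touch G A B) (hA : A ⊆ A') (hB : B ⊆ B') :
    Touch G A' B' := by
  obtain ⟨a, ha, b, hb, hab⟩ := h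
  exact ⟨a, hA ha, b, hB hb, hab⟩

/-- A cyclic sequence of sets in which `r` members touch both hubs yields a double wheel. -/
theorem isMinor_doubleWheel_of_cycle {f : ℕ → Set V} {a b : ℕ} {H₁ H₂ : Set V}
    (hf : ∀ i ∈ Set.Icc a b, ConnSet G (f i))
    (hfd : ∀ i ∈ Set.Icc a b, ∀ j ∈ Set.Icc a b, i ≠ j → Disjoint (f i) (f j))
    (hft : ∀ i, a ≤ i → i < b → Touch G (f i) (f (i + 1))) (hba : Touch G (f b) (f a))
    (h₁ : ConnSet G H₁) (h₂ : ConnSet G H₂) (h₁₂ : Disjoint H₁ H₂)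
    (hf₁ : ∀ i ∈ Set.Icc a b, Disjoint (f i) H₁) (hf₂ : ∀ i ∈ Set.Icc a b, Disjoint (f i) H₂)
    {J : Finset ℕ} (hJ : ∀ j ∈ J, j ∈ Set.Icc a b) (hJ₁ : ∀ j ∈ J, Touch G (f j) H₁)
    (hJ₂ : ∀ j ∈ J, Touch G (f j) H₂) : IsMinor (doubleWheel J.card) G := by
  set r := J.card with hr
  let e : Fin r ↪o ℕ := J.orderEmbOfFin rfl
  have he : ∀ t, e t ∈ J := fun t => J.orderEmbOfFin_mem rfl t
  let lo : Fin r → ℕ := fun t => if (t : ℕ) = 0 then a else e t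
  let hi : Fin r → ℕ := fun t => if h : (t : ℕ) + 1 < r then e ⟨t + 1, h⟩ else b + 1
  have hloa : ∀ t, a ≤ lo t ∧ lo t ≤ e t := by
    intro t
    have := (hJ _ (he t)).1
    simp only [lo]
    split_ifs <;> omega
  have hhib : ∀ t, e t < hi t ∧ hi t ≤ b + 1 := by
    intro t
    simp only [hi]
    split_ifs with h
    · have h1 : e t < e ⟨t + 1, h⟩ := e.lt_iff_lt.2 (Fin.lt_def.2 (by simp))
      have := (hJ _ (he ⟨t + 1, h⟩)).2
      omega
    · have := (hJ _ (he t)).2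
      omega
  have hmono : ∀ s t, s < t → hi s ≤ lo t := by
    intro s t hst
    have h1 : (s : ℕ) < t := hst
    have h2 : (s : ℕ) + 1 < r := by omega
    have h3 : e ⟨s + 1, h2⟩ ≤ e t := e.le_iff_le.2 (Fin.le_def.2 h1)
    simp only [hi, lo, dif_pos h2]
    rwa [if_neg (by omega)]
  let B : Fin r → Set V := fun t => {x | ∃ i ∈ Set.Ico (lo t) (hi t), x ∈ f i}
  have hIcc : ∀ t, ∀ i ∈ Set.Ico (lo t) (hi t), i ∈ Set.Icc a b := by
    rintro t i ⟨h1, h2⟩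
    have := hloa t
    have := hhib t
    exact ⟨by omega, by omega⟩
  have hsub : ∀ t, ∀ i ∈ Set.Ico (lo t) (hi t), f i ⊆ B t := fun t i hi x hx => ⟨i, hi, hx⟩
  have hself : ∀ t, f (e t) ⊆ B t := fun t => hsub t _ ⟨(hloa t).2, (hhib t).1⟩
  have hBc : ∀ t, ConnSet G (B t) := by
    intro t
    refine ConnSet.iUnion_ordConnected ⟨e t, (hloa t).2, (hhib t).1⟩ ?_
      (fun i hi => hf i (hIcc t i hi)) fun i hi hi' => ?_
    · rintro i hi k hk j hij hjk
      exact ⟨hi.1.trans hij, hjk.trans_lt hk.2⟩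
    · exact hft i (hIcc t i hi).1 (hIcc t _ hi').2
  have hBd : ∀ s t, s < t → Disjoint (B s) (B t) := by
    intro s t hst
    refine Set.disjoint_left.2 ?_
    rintro x ⟨i, hi, hx⟩ ⟨j, hj, hx'⟩
    have h1 := hi.2
    have h2 := hj.1
    have h3 := hmono s t hst
    exact Set.disjoint_left.1 (hfd i (hIcc s i hi) j (hIcc t j hj) (by omega)) hx hx'
  have hBH : ∀ H : Set V, (∀ i ∈ Set.Icc a b, Disjoint (f i) H) → ∀ t, Disjoint (B t) H := by
    intro H hH t
    refine Set.disjoint_left.2 ?_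
    rintro x ⟨i, hi, hx⟩
    exact Set.disjoint_left.1 (hH i (hIcc t i hi)) hx
  have hcyc : ∀ s t : Fin r, (t : ℕ) = (s + 1) % r → Touch G (B s) (B t) := by
    intro s t hst
    have hs := s.2
    have h1 := hloa s
    have h2 := hhib s
    have h3 := hloa t
    have h4 := hhib t
    by_cases h : (s : ℕ) + 1 < r
    · rw [Nat.mod_eq_of_lt h] at hst
      have h5 : lo t = hi s := by
        have : t = ⟨s + 1, h⟩ := Fin.ext hst
        simp only [hi, lo, dif_pos h]
        rw [if_neg (by omega), this]
      have h6 := hft (hi s - 1) (by omega) (by omega)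
      rw [Nat.sub_add_cancel (by omega)] at h6
      exact h6.mono (hsub s _ ⟨by omega, by omega⟩) (hsub t _ ⟨by omega, by omega⟩)
    · have h5 : (s : ℕ) + 1 = r := by omega
      rw [h5, Nat.mod_self] at hst
      have h6 : hi s = b + 1 := by simp only [hi, dif_neg h]
      have h7 : lo t = a := by simp only [lo, if_pos hst]
      exact hba.mono (hsub s _ ⟨by omega, by omega⟩) (hsub t _ ⟨by omega, by omega⟩)
  let H : Fin 2 → Set V := ![H₁, H₂]
  have hBHt : ∀ t k, Touch G (B t) (H k) := by
    intro t k
    fin_cases k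
    · exact (hJ₁ _ (he t)).mono (hself t) subset_rfl
    · exact (hJ₂ _ (he t)).mono (hself t) subset_rfl
  have hBHd : ∀ t k, Disjoint (B t) (H k) := by
    intro t k
    fin_cases k
    · exact hBH H₁ hf₁ t
    · exact hBH H₂ hf₂ t
  refine ⟨Sum.elim B H, ?_, ?_, ?_⟩
  · rintro (t | k)
    · exact hBc t
    · fin_cases k
      · exact h₁
      · exact h₂
  · rintro (s | k) (t | k') hne
    · have hne' : s ≠ t := fun h => hne (congrArg _ h)
      exact hne'.lt_or_gt.elim (hBd s t) fun h => (hBd t s h).symm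
    · exact hBHd s k'
    · exact (hBHd t k).symm
    · fin_cases k <;> fin_cases k'
      · exact (hne rfl).elim
      · exact h₁₂
      · exact h₁₂.symm
      · exact (hne rfl).elim
  · rintro (s | k) (t | k') hadj <;> rw [doubleWheel, fromRel_adj] at hadj
    · exact hadj.2.elim (hcyc s t) fun h => (hcyc t s h).symm
    · exact hBHt s k'
    · exact (hBHt t k).symm
    · exact (hadj.2.elim id id).elim

/-- Tree-indexed sets `M`, the first `m` and last `m` of which are joined by the sets `D`. -/
structure IsTreeLinkage (G : SimpleGraph V) (par : ℕ → ℕ) (w m : ℕ) (M : ℕ → Set V)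
    (D : Fin m → Set V) (σ : Fin m → ℕ) : Prop where
  connSet : ∀ i < w, ConnSet G (M i)
  disjoint : ∀ i < w, ∀ j < w, i ≠ j → Disjoint (M i) (M j)
  touch_parent : ∀ i < w, par i < i → Touch G (M i) (M (par i))
  link_connSet : ∀ i, ConnSet G (D i)
  link_disjoint : ∀ i j, i ≠ j → Disjoint (D i) (D j)
  disjoint_link : ∀ i < w, ∀ j, Disjoint (M i) (D j)
  connected : (touchGraph G D).Connected
  touch_start : ∀ i : Fin m, Touch G (M i) (D i)
  touch_end : ∀ i, Touch G (M (σ i)) (D i)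
  end_mem : ∀ i, w - m ≤ σ i ∧ σ i < w
  injective : Function.Injective σ

theorem exists_isTreeLinkage [Finite V] {𝔅 : Set (Set V)} (h𝔅 : IsBramble G 𝔅) {k w m : ℕ}
    (hk : ∀ X : Finset V, Covers X 𝔅 → k < X.card) (par : ℕ → ℕ) (hm : 0 < m) (hmw : 2 * m ≤ w)
    (hwk : w + m ≤ k + 1) : ∃ M D σ, IsTreeLinkage G par w m M D σ := by
  classical
  obtain ⟨M, v, C, h⟩ := exists_isRooted h𝔅 hk par (w := w) (by omega)
  have hcard := h.card
  have hmemS : ∀ i < w, v i ∈ (Finset.range w).image v := fun i hi =>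
    Finset.mem_image_of_mem v (Finset.mem_range.2 hi)
  have hY : (Finset.Ico (w - m) w).image v ⊆ (Finset.range w).image v :=
    Finset.image_subset_image fun i hi => Finset.mem_range.2 (Finset.mem_Ico.1 hi).2
  have hYm : ((Finset.Ico (w - m) w).image v).card = m := by
    rw [Finset.card_image_of_injOn, Nat.card_Ico]
    · omega
    · intro i hi j hj hij
      exact h.injOn i (Finset.mem_Ico.1 hi).2 j (Finset.mem_Ico.1 hj).2 hij
  have hxY : ∀ i : Fin m, v i ∉ (Finset.Ico (w - m) w).image v := by
    intro i hi
    obtain ⟨s, hs, hsi⟩ := Finset.mem_image.1 hi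
    have hs := Finset.mem_Ico.1 hs
    have := h.injOn s hs.2 i (by omega) hsi
    omega
  obtain ⟨D, y, hDc, hDC, hDd, hconn, hDx, hDy, hy, hyinj⟩ := exists_linkage_partition h𝔅 hk
    h.side (by rw [hcard]; exact h.tight) (x := fun i : Fin m => v i) hm
    (fun i => hmemS i (by omega)) (fun i j hij => Fin.ext (h.injOn i (by omega) j (by omega) hij))
    hY hYm hxY (by omega)
  have hσ : ∀ i, ∃ s, (w - m ≤ s ∧ s < w) ∧ v s = y i := fun i => by
    obtain ⟨s, hs, hsy⟩ := Finset.mem_image.1 (hy i)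
    exact ⟨s, Finset.mem_Ico.1 hs, hsy⟩
  choose σ hσ hσy using hσ
  refine ⟨M, D, σ, h.connSet, fun i hi j hj hij => Set.disjoint_left.2 fun x hx hx' =>
    hij (h.disjoint i hi j hj x hx hx'), h.adj, hDc, fun i j hij =>
    Set.disjoint_left.2 fun x hx hx' => hij (hDd i j x hx hx'), fun i hi j =>
    Set.disjoint_left.2 fun x hx hx' => h.avoid i hi x hx (hDC j hx'), hconn, fun i => ?_,
    fun i => ?_, hσ, fun i j hij => hyinj (by rw [← hσy i, ← hσy j, hij])⟩
  · obtain ⟨u, hu, hxu⟩ := hDx i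
    exact ⟨v i, h.mem i (by omega), u, hu, hxu⟩
  · obtain ⟨u, hu, hyu⟩ := hDy i
    exact ⟨v (σ i), h.mem _ (hσ i).2, u, hu, by rwa [hσy]⟩

end Assembly

section Heap

variable {V : Type*} {G : SimpleGraph V} {N : ℕ → Set V} {m : ℕ}

theorem div_two_pow_log {x : ℕ} (hx : x ≠ 0) : x / 2 ^ Nat.log 2 x = 1 := by
  refine Nat.div_eq_of_lt_le ?_ ?_
  · simpa using Nat.pow_log_le_self 2 hx
  · have := Nat.lt_pow_succ_log_self (b := 2) (by norm_num) x
    rw [pow_succ] at this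
    omega

open Classical in
/-- Leaf-to-root paths in the binary heap `1, …, 2 * m - 1` avoid the subtree below a suitable
node `y` that holds many of the leaves in `T`. -/
theorem exists_heap_subtree {u v : ℕ} {T : Finset ℕ} (hT : ∀ t ∈ T, m ≤ t ∧ t < 2 * m)
    (hne : T.Nonempty) (hu : m ≤ u ∧ u < 2 * m) (hv : m ≤ v ∧ v < 2 * m) (huT : u ∉ T)
    (hvT : v ∉ T) : ∃ y, 0 < y ∧ y < 2 * m ∧ (∀ k, u / 2 ^ k ≠ y) ∧ (∀ k, v / 2 ^ k ≠ y) ∧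
      T.card ≤ 2 * Nat.log 2 (2 * m - 1) * {t ∈ T | ∃ k, t / 2 ^ k = y}.card := by
  classical
  have hm : 0 < m := by omega
  set h := Nat.log 2 (2 * m - 1) with hh
  let P : ℕ → Prop := fun y => 0 < y ∧ y < 2 * m ∧ (∀ k, u / 2 ^ k ≠ y) ∧ ∀ k, v / 2 ^ k ≠ y
  let sib : ℕ → ℕ := fun x => 4 * (x / 2) + 1 - x
  let cand : Finset ℕ := (Finset.range h).image (fun b => sib (u / 2 ^ b)) ∪
    (Finset.range h).image fun b => sib (v / 2 ^ b)
  have hcand : cand.card ≤ 2 * h := by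
    refine (Finset.card_union_le _ _).trans ?_
    have h1 := Finset.card_image_le (s := Finset.range h) (f := fun b => sib (u / 2 ^ b))
    have h2 := Finset.card_image_le (s := Finset.range h) (f := fun b => sib (v / 2 ^ b))
    rw [Finset.card_range] at h1 h2
    omega
  have hlog : ∀ x < 2 * m, ∀ b, 0 < x / 2 ^ (b + 1) → b < h := by
    intro x hx b hb
    have h1 : 2 ^ (b + 1) ≤ x := by
      by_contra! hlt
      rw [Nat.div_eq_of_lt hlt] at hb
      omega
    exact Nat.le_log_of_pow_le (by norm_num) (by omega)
  have hroot : ∀ x, m ≤ x ∧ x < 2 * m → x / 2 ^ Nat.log 2 x = 1 := fun x hx =>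
    div_two_pow_log (by omega)
  have hex : ∀ t ∈ T, ∃ y ∈ cand, P y ∧ ∃ k, t / 2 ^ k = y := by
    intro t ht
    have htm := hT t ht
    let Q : ℕ → Prop := fun k => 0 < t / 2 ^ k ∧ ((∃ b, u / 2 ^ b = t / 2 ^ k) ∨
      ∃ b, v / 2 ^ b = t / 2 ^ k)
    have hQ : ∃ k, Q k := ⟨_, by rw [hroot t htm]; exact one_pos,
      Or.inl ⟨_, (hroot u hu).trans (hroot t htm).symm⟩⟩
    have hleaf : ∀ x, m ≤ x ∧ x < 2 * m → x ≠ t → ∀ b, x / 2 ^ b ≠ t := by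
      rintro x hx hxt (_ | b) hb
      · simp at hb; exact hxt hb
      · rw [pow_succ', ← Nat.div_div_eq_div_mul] at hb
        have := Nat.div_le_self (x / 2) (2 ^ b)
        omega
    have h0 : ¬ Q 0 := by
      rintro ⟨-, ⟨b, hb⟩ | ⟨b, hb⟩⟩ <;> rw [pow_zero, Nat.div_one] at hb
      · exact hleaf u hu (fun e => huT (e ▸ ht)) b hb
      · exact hleaf v hv (fun e => hvT (e ▸ ht)) b hb
    obtain ⟨k, hk⟩ : ∃ k, Nat.find hQ = k + 1 :=
      Nat.exists_eq_succ_of_ne_zero fun e => h0 (e ▸ Nat.find_spec hQ)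
    have hQ1 : Q (k + 1) := hk ▸ Nat.find_spec hQ
    have hQ2 : ¬ Q k := Nat.find_min hQ (by omega)
    have hhalf : t / 2 ^ (k + 1) = t / 2 ^ k / 2 := by rw [pow_succ, Nat.div_div_eq_div_mul]
    have hyt : t / 2 ^ k ≤ t := Nat.div_le_self _ _
    have hpos : 0 < t / 2 ^ k := by
      have := hQ1.1
      omega
    have hPy : P (t / 2 ^ k) := ⟨hpos, by omega, fun b hb => hQ2 ⟨hpos, Or.inl ⟨b, hb⟩⟩,
      fun b hb => hQ2 ⟨hpos, Or.inr ⟨b, hb⟩⟩⟩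
    have hmem : ∀ x, m ≤ x ∧ x < 2 * m → (∀ b, x / 2 ^ b ≠ t / 2 ^ k) →
        (∃ b, x / 2 ^ b = t / 2 ^ (k + 1)) → ∃ b < h, sib (x / 2 ^ b) = t / 2 ^ k := by
      rintro x hx hne ⟨_ | b, hb⟩
      · rw [pow_zero, Nat.div_one] at hb
        omega
      · refine ⟨b, hlog x hx.2 b (hb ▸ hQ1.1), ?_⟩
        have h1 := hne b
        rw [pow_succ, ← Nat.div_div_eq_div_mul] at hb
        simp only [sib]
        omega
    refine ⟨t / 2 ^ k, Finset.mem_union.2 ?_, hPy, k, rfl⟩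
    refine hQ1.2.imp (fun hb => ?_) fun hb => ?_
    · obtain ⟨b, hbh, hb⟩ := hmem u hu hPy.2.2.1 hb
      exact Finset.mem_image.2 ⟨b, Finset.mem_range.2 hbh, hb⟩
    · obtain ⟨b, hbh, hb⟩ := hmem v hv hPy.2.2.2 hb
      exact Finset.mem_image.2 ⟨b, Finset.mem_range.2 hbh, hb⟩
  choose! g hg hgP hgt using hex
  obtain ⟨t₀, ht₀, hmax⟩ := T.exists_max_image (fun t => {s ∈ T | g s = g t}.card) hne
  obtain ⟨h1, h2, h3, h4⟩ := hgP t₀ ht₀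
  refine ⟨g t₀, h1, h2, h3, h4, ?_⟩
  have hle : T.card ≤ {s ∈ T | g s = g t₀}.card * (T.image g).card := by
    refine Finset.card_le_mul_card_image_of_maps_to
      (fun s hs => Finset.mem_image_of_mem g hs) _ fun b hb => ?_
    obtain ⟨s, hs, rfl⟩ := Finset.mem_image.1 hb
    exact hmax s hs
  have hle' : (T.image g).card ≤ 2 * h :=
    (Finset.card_le_card (Finset.image_subset_iff.2 hg)).trans hcand
  have hle'' : {s ∈ T | g s = g t₀}.card ≤ {t ∈ T | ∃ k, t / 2 ^ k = g t₀}.card := by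
    refine Finset.card_le_card fun s hs => ?_
    rw [Finset.mem_filter] at hs ⊢
    exact ⟨hs.1, hs.2 ▸ hgt s hs.1⟩
  calc T.card ≤ _ := hle
    _ ≤ _ := Nat.mul_le_mul hle'' hle'
    _ = _ := mul_comm _ _

/-- Sets indexed by the binary heap `1, …, 2 * m - 1` whose members touch their parents. -/
structure IsHeap (G : SimpleGraph V) (m : ℕ) (N : ℕ → Set V) : Prop where
  connSet : ∀ i, 0 < i → i < 2 * m → ConnSet G (N i)
  disjoint : ∀ i j, 0 < i → i < 2 * m → 0 < j → j < 2 * m → i ≠ j → Disjoint (N i) (N j)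
  touch : ∀ i, 2 ≤ i → i < 2 * m → Touch G (N i) (N (i / 2))

theorem IsHeap.ancestors_connSet (hN : IsHeap G m N) {i k : ℕ} (hi : i < 2 * m)
    (hk : 0 < i / 2 ^ k) : ConnSet G {x | ∃ b ∈ Set.Iic k, x ∈ N (i / 2 ^ b)} := by
  have hpos : ∀ b ≤ k, 0 < i / 2 ^ b := fun b hb =>
    hk.trans_le (Nat.div_le_div_left (Nat.pow_le_pow_right (by norm_num) hb) (by positivity))
  have hlt : ∀ b, i / 2 ^ b < 2 * m := fun b => (Nat.div_le_self _ _).trans_lt hi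
  refine ConnSet.iUnion_ordConnected (f := fun b => N (i / 2 ^ b)) ⟨0, Nat.zero_le _⟩
    (fun a _ c hc b _ hbc => hbc.trans hc) (fun b hb => hN.connSet _ (hpos b hb) (hlt b))
    fun b _ hb => ?_
  have h1 := hpos (b + 1) hb
  have h2 : i / 2 ^ (b + 1) = i / 2 ^ b / 2 := by rw [pow_succ, Nat.div_div_eq_div_mul]
  have h3 := hN.touch (i / 2 ^ b) (by omega) (hlt b)
  rwa [← h2] at h3

theorem IsHeap.subtree_connSet (hN : IsHeap G m N) {y : ℕ} (hy : 0 < y) (hym : y < 2 * m) :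
    ConnSet G {x | ∃ i, (i < 2 * m ∧ ∃ k, i / 2 ^ k = y) ∧ x ∈ N i} := by
  obtain ⟨c, hc⟩ := (hN.connSet y hy hym).nonempty
  refine ConnSet.of_patches (u := c) ⟨y, ⟨hym, 0, by simp⟩, hc⟩ ?_
  rintro x ⟨i, ⟨him, k, hk⟩, hx⟩
  refine ⟨{z | ∃ b ∈ Set.Iic k, z ∈ N (i / 2 ^ b)}, ?_, ⟨k, Set.mem_Iic.2 le_rfl, hk ▸ hc⟩,
    ⟨0, Nat.zero_le _, by simpa using hx⟩, hN.ancestors_connSet him (hk ▸ hy)⟩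
  rintro z ⟨b, hb, hz⟩
  refine ⟨i / 2 ^ b, ⟨(Nat.div_le_self _ _).trans_lt him, k - b, ?_⟩, hz⟩
  rw [Nat.div_div_eq_div_mul, ← pow_add, Nat.add_sub_cancel' hb, hk]

/-- A sequence of sets whose marked members, including both ends, touch distinct leaves of a
heap yields a double wheel. -/
theorem IsHeap.exists_doubleWheel (hN : IsHeap G m N) {f : ℕ → Set V} {a b : ℕ} {H : Set V}
    {J : Finset ℕ} {τ : ℕ → ℕ} (hf : ∀ i ∈ Set.Icc a b, ConnSet G (f i))
    (hfd : ∀ i ∈ Set.Icc a b, ∀ j ∈ Set.Icc a b, i ≠ j → Disjoint (f i) (f j))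
    (hft : ∀ i, a ≤ i → i < b → Touch G (f i) (f (i + 1)))
    (hH : ConnSet G H) (hfH : ∀ i ∈ Set.Icc a b, Disjoint (f i) H)
    (hNf : ∀ i, 0 < i → i < 2 * m → ∀ j ∈ Set.Icc a b, Disjoint (N i) (f j))
    (hNH : ∀ i, 0 < i → i < 2 * m → Disjoint (N i) H)
    (hJ : ∀ j ∈ J, j ∈ Set.Icc a b) (ha : a ∈ J) (hb : b ∈ J) (hcard : 2 < J.card)
    (hJH : ∀ j ∈ J, Touch G (f j) H) (hτ : ∀ j ∈ J, m ≤ τ j ∧ τ j < 2 * m)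
    (hJτ : ∀ j ∈ J, Touch G (f j) (N (τ j))) (hτinj : Set.InjOn τ J) :
    ∃ r, J.card ≤ 2 * Nat.log 2 (2 * m - 1) * r + 2 ∧ IsMinor (doubleWheel r) G := by
  classical
  have hm : 0 < m := by
    have := hτ a ha
    omega
  set I := (J.erase a).erase b with hI
  have hIJ : ∀ j ∈ I, j ∈ J ∧ j ≠ a ∧ j ≠ b := fun j hj => by
    simp only [hI, Finset.mem_erase] at hj
    exact ⟨hj.2.2, hj.2.1, hj.1⟩
  have hIcard : J.card ≤ I.card + 2 := by
    have h1 := Finset.pred_card_le_card_erase (s := J) (a := a)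
    have h2 := Finset.pred_card_le_card_erase (s := J.erase a) (a := b)
    rw [hI]
    omega
  have hinj : Set.InjOn τ I := hτinj.mono fun j hj => (hIJ j hj).1
  obtain ⟨y, hy0, hym, hyu, hyv, hcut⟩ := exists_heap_subtree (m := m) (T := I.image τ)
    (u := τ a) (v := τ b)
    (by
      intro t ht
      obtain ⟨j, hj, rfl⟩ := Finset.mem_image.1 ht
      exact hτ j (hIJ j hj).1)
    ((Finset.card_pos.1 (by omega)).image τ) (hτ a ha) (hτ b hb)
    (by
      intro ht
      obtain ⟨j, hj, hjt⟩ := Finset.mem_image.1 ht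
      exact (hIJ j hj).2.1 (hτinj (hIJ j hj).1 ha hjt))
    (by
      intro ht
      obtain ⟨j, hj, hjt⟩ := Finset.mem_image.1 ht
      exact (hIJ j hj).2.2 (hτinj (hIJ j hj).1 hb hjt))
  set L := {j ∈ I | ∃ k, τ j / 2 ^ k = y} with hL
  have hLJ : ∀ j ∈ L, j ∈ J := fun j hj => (hIJ j (Finset.mem_filter.1 hj).1).1
  have hLcard : {t ∈ I.image τ | ∃ k, t / 2 ^ k = y}.card = L.card := by
    rw [Finset.filter_image, Finset.card_image_of_injOn]
    exact hinj.mono fun j hj => (Finset.mem_filter.1 hj).1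
  rw [Finset.card_image_of_injOn hinj, hLcard] at hcut
  refine ⟨L.card, by omega, ?_⟩
  have hroot : ∀ x, m ≤ x ∧ x < 2 * m → x / 2 ^ Nat.log 2 x = 1 := fun x hx =>
    div_two_pow_log (by omega)
  have hanc : ∀ j ∈ J, ConnSet G {x | ∃ b ∈ Set.Iic (Nat.log 2 (τ j)), x ∈ N (τ j / 2 ^ b)} :=
    fun j hj => hN.ancestors_connSet (hτ j hj).2 (by rw [hroot _ (hτ j hj)]; exact one_pos)
  set anc : ℕ → Set V := fun j => {x | ∃ b ∈ Set.Iic (Nat.log 2 (τ j)), x ∈ N (τ j / 2 ^ b)}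
  have hancN : ∀ j ∈ J, ∀ x ∈ anc j, ∃ i, 0 < i ∧ i < 2 * m ∧ (∃ k, τ j / 2 ^ k = i) ∧ x ∈ N i := by
    rintro j hj x ⟨k, hk, hx⟩
    refine ⟨_, ?_, (Nat.div_le_self _ _).trans_lt (hτ j hj).2, ⟨k, rfl⟩, hx⟩
    have h1 := hτ j hj
    refine Nat.div_pos ?_ (by positivity)
    exact (Nat.pow_le_pow_right (by norm_num) hk).trans (Nat.pow_log_le_self 2 (by omega))
  set W := anc a ∪ anc b
  have hWN : ∀ x ∈ W, ∃ i, 0 < i ∧ i < 2 * m ∧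
      ((∃ k, τ a / 2 ^ k = i) ∨ ∃ k, τ b / 2 ^ k = i) ∧ x ∈ N i := by
    rintro x (hx | hx)
    · obtain ⟨i, h1, h2, h3, h4⟩ := hancN a ha x hx
      exact ⟨i, h1, h2, Or.inl h3, h4⟩
    · obtain ⟨i, h1, h2, h3, h4⟩ := hancN b hb x hx
      exact ⟨i, h1, h2, Or.inr h3, h4⟩
  have hW : ConnSet G W := by
    obtain ⟨c, hc⟩ := (hN.connSet 1 one_pos (by omega)).nonempty
    exact (hanc a ha).union (hanc b hb) ⟨c, ⟨_, Set.mem_Iic.2 le_rfl, by rwa [hroot _ (hτ a ha)]⟩,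
      ⟨_, Set.mem_Iic.2 le_rfl, by rwa [hroot _ (hτ b hb)]⟩⟩
  have hself : ∀ j, N (τ j) ⊆ anc j := fun j x hx => ⟨0, Nat.zero_le _, by simpa using hx⟩
  set H₂ := {x | ∃ i, (i < 2 * m ∧ ∃ k, i / 2 ^ k = y) ∧ x ∈ N i} with hH₂
  have hpos : ∀ i k, i / 2 ^ k = y → 0 < i := fun i k h => by
    rcases Nat.eq_zero_or_pos i with rfl | h'
    · simp at h
      omega
    · exact h'
  have hWf : ∀ j ∈ Set.Icc a b, Disjoint W (f j) := fun j hj => Set.disjoint_left.2 fun x hx => by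
    obtain ⟨i, h1, h2, -, h4⟩ := hWN x hx
    exact Set.disjoint_left.1 (hNf i h1 h2 j hj) h4
  have hWH : Disjoint W H := Set.disjoint_left.2 fun x hx => by
    obtain ⟨i, h1, h2, -, h4⟩ := hWN x hx
    exact Set.disjoint_left.1 (hNH i h1 h2) h4
  have hWH₂ : Disjoint W H₂ := by
    refine Set.disjoint_left.2 ?_
    rintro x hx ⟨i', ⟨hi', k', hk'⟩, hx'⟩
    obtain ⟨i, h1, h2, h3, h4⟩ := hWN x hx
    obtain rfl : i = i' := by
      by_contra hne
      exact Set.disjoint_left.1 (hN.disjoint i i' h1 h2 (hpos _ _ hk') hi' hne) h4 hx'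
    rcases h3 with ⟨k, rfl⟩ | ⟨k, rfl⟩ <;> rw [Nat.div_div_eq_div_mul, ← pow_add] at hk'
    · exact hyu _ hk'
    · exact hyv _ hk'
  have hfH₂ : ∀ j ∈ Set.Icc a b, Disjoint (f j) H₂ := fun j hj => by
    refine Set.disjoint_right.2 ?_
    rintro x ⟨i, ⟨hi, k, hk⟩, hx⟩
    exact Set.disjoint_left.1 (hNf i (hpos _ _ hk) hi j hj) hx
  have hHH₂ : Disjoint H H₂ := by
    refine Set.disjoint_right.2 ?_
    rintro x ⟨i, ⟨hi, k, hk⟩, hx⟩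
    exact Set.disjoint_left.1 (hNH i (hpos _ _ hk) hi) hx
  have hab : a ≤ b := (hJ a ha).2
  have hup : ∀ i ∈ Set.Icc a b, Function.update f (b + 1) W i = f i := fun i hi =>
    Function.update_of_ne (by have := hi.2; omega) _ _
  have hlast : Function.update f (b + 1) W (b + 1) = W := Function.update_self _ _ _
  have hall : ∀ i ∈ Set.Icc a (b + 1), i ∈ Set.Icc a b ∨ i = b + 1 := fun i hi => by
    have := hi.1
    have := hi.2
    by_cases h : i = b + 1
    · exact Or.inr h
    · exact Or.inl ⟨by omega, by omega⟩
  refine isMinor_doubleWheel_of_cycle (f := Function.update f (b + 1) W) (a := a) (b := b + 1)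
    (H₁ := H) (H₂ := H₂) ?_ ?_ ?_ ?_ hH (hN.subtree_connSet hy0 hym) hHH₂ ?_ ?_ ?_ ?_ ?_
  · intro i hi
    rcases hall i hi with h | rfl
    · rw [hup i h]
      exact hf i h
    · rwa [hlast]
  · intro i hi j hj hij
    rcases hall i hi with h | rfl <;> rcases hall j hj with h' | rfl
    · rw [hup i h, hup j h']
      exact hfd i h j h' hij
    · rw [hup i h, hlast]
      exact (hWf i h).symm
    · rw [hup j h', hlast]
      exact hWf j h'
    · exact (hij rfl).elim
  · intro i hai hib
    rw [hup i ⟨hai, by omega⟩]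
    by_cases h : i = b
    · subst h
      rw [hlast]
      exact (hJτ i hb).mono subset_rfl ((hself i).trans Set.subset_union_right)
    · rw [hup (i + 1) ⟨by omega, by omega⟩]
      exact hft i hai (by omega)
  · rw [hlast, hup a ⟨le_rfl, hab⟩]
    exact ((hJτ a ha).mono subset_rfl ((hself a).trans Set.subset_union_left)).symm
  · intro i hi
    rcases hall i hi with h | rfl
    · rw [hup i h]
      exact hfH i h
    · rwa [hlast]
  · intro i hi
    rcases hall i hi with h | rfl
    · rw [hup i h]
      exact hfH₂ i h
    · rwa [hlast]
  · intro j hj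
    have := hJ j (hLJ j hj)
    exact ⟨this.1, this.2.trans (by omega)⟩
  · intro j hj
    rw [hup j (hJ j (hLJ j hj))]
    exact hJH j (hLJ j hj)
  · intro j hj
    rw [hup j (hJ j (hLJ j hj))]
    exact (hJτ j (hLJ j hj)).mono subset_rfl fun x hx =>
      ⟨τ j, ⟨(hτ j (hLJ j hj)).2, (Finset.mem_filter.1 hj).2⟩, hx⟩

end Heap

section Extraction

/-- A connected graph on more than `(n - 1) ^ 2` vertices contains a path on `n` vertices or a
connected set with at least `n` neighbours. -/
theorem exists_path_or_large_neighborhood {ι : Type*} [Fintype ι] {T : SimpleGraph ι}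
    (hT : T.Connected) {n : ℕ} (hn : 2 ≤ n) (hcard : (n - 1) ^ 2 < Fintype.card ι) :
    (∃ q : ℕ → ι, (∀ i < n, ∀ j < n, q i = q j → i = j) ∧
      ∀ i, i + 1 < n → T.Adj (q i) (q (i + 1))) ∨
    ∃ (I : Set ι) (L : Finset ι), ConnSet T I ∧ n ≤ L.card ∧
      ∀ j ∈ L, j ∉ I ∧ ∃ i ∈ I, T.Adj i j := by
  classical
  obtain ⟨r⟩ := hT.nonempty
  by_cases hfar : ∃ v, n - 1 ≤ T.dist r v
  · obtain ⟨v, hv⟩ := hfar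
    obtain ⟨p, hp, hlen⟩ := hT.exists_path_of_dist r v
    refine Or.inl ⟨p.getVert, fun i hi j hj hij => hp.getVert_injOn ?_ ?_ hij, fun i hi =>
      p.adj_getVert_succ (by omega)⟩
    · rw [Set.mem_ofPred_eq]
      omega
    · rw [Set.mem_ofPred_eq]
      omega
  · push Not at hfar
    obtain ⟨k, hk⟩ : ∃ k ≠ 0, n ≤ (Finset.univ.filter fun v => T.dist r v = k).card := by
      by_contra! hsmall
      have h1 := Finset.card_eq_sum_card_fiberwise (s := (Finset.univ : Finset ι))
        (t := Finset.range (n - 1)) (f := T.dist r) fun v _ => by simpa using hfar v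
      obtain ⟨N, rfl⟩ : ∃ N, n = N + 2 := ⟨n - 2, by omega⟩
      have h2 : (Finset.univ.filter fun v => T.dist r v = 0).card ≤ 1 := by
        refine Finset.card_le_one_iff.2 fun {a b} ha hb => ?_
        rw [Finset.mem_filter] at ha hb
        rw [← hT.dist_eq_zero_iff.1 ha.2, hT.dist_eq_zero_iff.1 hb.2]
      have h3 : ∑ k ∈ Finset.range N, (Finset.univ.filter fun v => T.dist r v = k + 1).card ≤
          N * (N + 1) := by
        refine (Finset.sum_le_card_nsmul _ _ (N + 1) fun k _ => ?_).trans (by simp)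
        have := hsmall (k + 1) (by omega)
        omega
      rw [Finset.card_univ, show N + 2 - 1 = N + 1 by omega, Finset.sum_range_succ'] at h1
      rw [show N + 2 - 1 = N + 1 by omega] at hcard
      nlinarith
    refine Or.inr ⟨{v | T.dist r v < k}, _, ?_, hk.2, fun j hj => ?_⟩
    · refine ConnSet.of_patches (u := r) ?_ fun v hv => ?_
      · rw [Set.mem_ofPred_eq, dist_self]
        omega
      · obtain ⟨p, hp⟩ := hT.exists_walk_length_eq_dist r v
        refine ⟨{x | x ∈ p.support}, fun x hx => ?_, p.start_mem_support, p.end_mem_support,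
          ConnSet.support p⟩
        have h1 := dist_le (p.takeUntil x hx)
        have h2 := p.length_takeUntil_le_length hx
        rw [Set.mem_ofPred_eq] at hv ⊢
        omega
    · have hj := (Finset.mem_filter.1 hj).2
      refine ⟨by simp [hj], ?_⟩
      obtain ⟨p, hp⟩ := hT.exists_walk_length_eq_dist r j
      have h1 : ¬ p.Nil := by
        rw [← Walk.length_eq_zero_iff]
        omega
      refine ⟨p.penultimate, ?_, p.adj_penultimate h1⟩
      have h2 := dist_le p.dropLast
      have h3 : p.dropLast.length + 1 = p.length := Walk.length_dropLast_add_one h1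
      rw [Set.mem_ofPred_eq]
      omega

variable {V : Type*} {G : SimpleGraph V} {M : ℕ → Set V}

theorem IsTreeLinkage.isMinor_doubleWheel_three {D : Fin 3 → Set V} {σ : Fin 3 → ℕ}
    (h : IsTreeLinkage G (fun i => i - 1) 6 3 M D σ) : IsMinor (doubleWheel 3) G := by
  have hnb : ∀ i, ∃ j, (touchGraph G D).Adj i j := fun i =>
    h.connected.preconnected.exists_adj_of_nontrivial i
  obtain ⟨b, c, d, hcd, hbc, hbd⟩ : ∃ b c d, c ≠ d ∧ (touchGraph G D).Adj b c ∧
      (touchGraph G D).Adj b d := by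
    obtain ⟨x, hx⟩ := hnb 0
    obtain ⟨z, hz0, hzx⟩ : ∃ z : Fin 3, z ≠ 0 ∧ z ≠ x := by
      clear hx
      revert x
      decide
    obtain ⟨y, hy⟩ := hnb z
    obtain rfl | rfl : y = 0 ∨ y = x := by
      have h1 := hx.1
      have h2 := hy.1
      omega
    · exact ⟨0, x, z, hzx.symm, hx, hy.symm⟩
    · exact ⟨y, 0, z, hz0.symm, hx.symm, hy.symm⟩
  let A : ℕ → Set V := fun s => {x | ∃ i ∈ Set.Ico (3 * s) (3 * s + 3), x ∈ M i}
  have hA : ∀ s < 2, ConnSet G (A s) := fun s hs =>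
    ConnSet.iUnion_ordConnected ⟨3 * s, le_rfl, by omega⟩
      (fun i hi k hk j hij hjk => ⟨hi.1.trans hij, hjk.trans_lt hk.2⟩)
      (fun i hi => h.connSet i (by have := hi.2; omega))
      fun i _ hi => (h.touch_parent (i + 1) (by have := hi.2; omega) (by omega)).symm
  have hMA : ∀ s i, 3 * s ≤ i → i < 3 * s + 3 → M i ⊆ A s := fun s i h1 h2 x hx =>
    ⟨i, ⟨h1, h2⟩, hx⟩
  have hAD : ∀ s < 2, ∀ i, Disjoint (A s) (D i) := fun s hs i => by
    refine Set.disjoint_left.2 ?_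
    rintro x ⟨j, hj, hx⟩
    exact Set.disjoint_left.1 (h.disjoint_link j (by have := hj.2; omega) i) hx
  have hAA : Disjoint (A 0) (A 1) := by
    refine Set.disjoint_left.2 ?_
    rintro x ⟨i, hi, hx⟩ ⟨j, hj, hx'⟩
    have h1 := hi.2
    have h2 := hj.1
    have h3 := hj.2
    exact Set.disjoint_left.1 (h.disjoint i (by omega) j (by omega) (by omega)) hx hx'
  have hAt : ∀ s < 2, ∀ i, Touch G (A s) (D i) := by
    intro s hs i
    have h1 := h.end_mem i
    obtain rfl | rfl : s = 0 ∨ s = 1 := by omega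
    · exact (h.touch_start i).mono (hMA 0 i (by omega) (by omega)) subset_rfl
    · exact (h.touch_end i).mono (hMA 1 _ (by omega) (by omega)) subset_rfl
  have hAA' : Touch G (A 0) (A 1) := (h.touch_parent 3 (by omega) (by omega)).symm.mono
    (hMA 0 2 (by omega) (by omega)) (hMA 1 3 (by omega) (by omega))
  let f : ℕ → Set V := fun s => if s < 2 then A s else D b
  have hcases : ∀ s ∈ Set.Icc 0 2, s = 0 ∨ s = 1 ∨ s = 2 := fun s hs => by
    have := hs.2
    omega
  have hfD : ∀ i, b ≠ i → ∀ s ∈ Set.Icc 0 2, Disjoint (f s) (D i) := by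
    intro i hbi s hs
    obtain rfl | rfl | rfl := hcases s hs
    · exact hAD 0 (by omega) i
    · exact hAD 1 (by omega) i
    · exact h.link_disjoint b i hbi
  have hft : ∀ i, (touchGraph G D).Adj b i → ∀ s ∈ Finset.range 3, Touch G (f s) (D i) := by
    intro i hbi s hs
    obtain rfl | rfl | rfl := hcases s ⟨by omega, Nat.lt_succ_iff.1 (Finset.mem_range.1 hs)⟩
    · exact hAt 0 (by omega) i
    · exact hAt 1 (by omega) i
    · exact hbi.2
  have := isMinor_doubleWheel_of_cycle (G := G) (f := f) (a := 0) (b := 2) (H₁ := D c)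
    (H₂ := D d) (J := Finset.range 3)
    (by
      intro s hs
      obtain rfl | rfl | rfl := hcases s hs
      · exact hA 0 (by omega)
      · exact hA 1 (by omega)
      · exact h.link_connSet b)
    (by
      intro s hs t ht hst
      obtain rfl | rfl | rfl := hcases s hs <;> obtain rfl | rfl | rfl := hcases t ht
      · exact (hst rfl).elim
      · exact hAA
      · exact hAD 0 (by omega) b
      · exact hAA.symm
      · exact (hst rfl).elim
      · exact hAD 1 (by omega) b
      · exact (hAD 0 (by omega) b).symm
      · exact (hAD 1 (by omega) b).symm
      · exact (hst rfl).elim)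
    (by
      intro s _ hs
      obtain rfl | rfl : s = 0 ∨ s = 1 := by omega
      · exact hAA'
      · exact hAt 1 (by omega) b)
    (hAt 0 (by omega) b).symm (h.link_connSet c) (h.link_connSet d) (h.link_disjoint c d hcd)
    (hfD c hbc.1) (hfD d hbd.1)
    (fun j hj => ⟨by omega, Nat.lt_succ_iff.1 (Finset.mem_range.1 hj)⟩) (hft c hbc) (hft d hbd)
  rwa [Finset.card_range] at this

/-- The parent function of the path `0, …, m - 1` followed by the binary heap `1, …, 2 * m - 1`,
whose node `a` has index `m + a - 1`. -/
def pathHeapParent (m i : ℕ) : ℕ := if i < m then i - 1 else m + (i + 1 - m) / 2 - 1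

theorem IsTreeLinkage.exists_doubleWheel {m : ℕ} {D : Fin m → Set V} {σ : Fin m → ℕ}
    (h : IsTreeLinkage G (pathHeapParent m) (3 * m - 1) m M D σ) {n : ℕ} (hn : 2 < n)
    (hnm : (n - 1) ^ 2 < m) :
    ∃ r, n ≤ 2 * Nat.log 2 (2 * m - 1) * r + 2 ∧ IsMinor (doubleWheel r) G := by
  classical
  have hheap : IsHeap G m fun a => M (m + a - 1) := by
    refine ⟨fun i h0 hi => h.connSet _ (by omega), fun i j _ hi _ hj hij =>
      h.disjoint _ (by omega) _ (by omega) (by omega), fun i h2 hi => ?_⟩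
    have h3 : pathHeapParent m (m + i - 1) = m + i / 2 - 1 := by
      rw [pathHeapParent, if_neg (by omega), show m + i - 1 + 1 - m = i by omega]
    have h4 := h.touch_parent (m + i - 1) (by omega) (by rw [h3]; omega)
    rwa [h3] at h4
  have hleaf : ∀ i, m ≤ σ i + 1 - m ∧ σ i + 1 - m < 2 * m := fun i => by
    have := h.end_mem i
    omega
  have hleaf' : ∀ i, m + (σ i + 1 - m) - 1 = σ i := fun i => by
    have := h.end_mem i
    omega
  have hpath : ∀ i, i + 1 < m → Touch G (M i) (M (i + 1)) := fun i hi => by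
    have h1 : pathHeapParent m (i + 1) = i := by rw [pathHeapParent, if_pos hi]; omega
    have h2 := h.touch_parent (i + 1) (by omega) (by omega)
    rw [h1] at h2
    exact h2.symm
  rcases exists_path_or_large_neighborhood h.connected (n := n) hn.le (by rwa [Fintype.card_fin])
    with ⟨q, hq, hqt⟩ | ⟨I, L, hI, hL, hLI⟩
  · have hqd : ∀ i ∈ Set.Icc 0 (n - 1), ∀ j ∈ Set.Icc 0 (n - 1), i ≠ j →
        Disjoint (D (q i)) (D (q j)) := fun i hi j hj hij => h.link_disjoint _ _ fun he =>
      hij (hq i (by have := hi.2; omega) j (by have := hj.2; omega) he)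
    have := hheap.exists_doubleWheel (f := fun i => D (q i)) (a := 0) (b := n - 1)
      (H := {x | ∃ i ∈ Set.Iio m, x ∈ M i}) (J := Finset.range n)
      (τ := fun i => σ (q i) + 1 - m)
      (fun i _ => h.link_connSet _) hqd (fun i _ hi => (hqt i (by omega)).2)
      (ConnSet.iUnion_ordConnected ⟨0, Set.mem_Iio.2 (by omega)⟩
        (fun i _ k hk j _ hjk => hjk.trans_lt hk) (fun i hi => h.connSet i (by
          have := Set.mem_Iio.1 hi; omega)) fun i _ hi => hpath i hi)
      (fun i _ => Set.disjoint_right.2 fun x ⟨j, hj, hx⟩ =>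
        Set.disjoint_left.1 (h.disjoint_link j (by have := Set.mem_Iio.1 hj; omega) (q i)) hx)
      (fun i h0 hi j _ => h.disjoint_link _ (by omega) _)
      (fun i h0 hi => Set.disjoint_right.2 fun x ⟨j, hj, hx⟩ => by
        have := Set.mem_Iio.1 hj
        exact Set.disjoint_left.1 (h.disjoint j (by omega) (m + i - 1) (by omega) (by omega)) hx)
      (fun j hj => ⟨by omega, by have := Finset.mem_range.1 hj; omega⟩)
      (Finset.mem_range.2 (by omega)) (Finset.mem_range.2 (by omega))
      (by rwa [Finset.card_range])
      (fun j _ => (h.touch_start (q j)).symm.mono subset_rfl fun x hx =>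
        ⟨q j, Set.mem_Iio.2 (q j).2, hx⟩)
      (fun j _ => hleaf _)
      (fun j _ => by
        simp only [hleaf']
        exact (h.touch_end _).symm)
      (fun i hi j hj hij => hq i (Finset.mem_range.1 hi) j (Finset.mem_range.1 hj)
        (h.injective (by
          have h1 := hleaf' (q i)
          have h2 := hleaf' (q j)
          simp only at hij
          rw [← h1, ← h2, hij])))
    rwa [Finset.card_range] at this
  · let E : ℕ → Set V := fun j => {x | ∃ i ∈ L, (i : ℕ) = j ∧ x ∈ D i}
    let J : Finset ℕ := L.map Fin.valEmbedding
    have hJcard : J.card = L.card := Finset.card_map _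
    have hJ : ∀ j, j ∈ J ↔ ∃ i ∈ L, (i : ℕ) = j := fun j => by
      simp [J]
    have hJne : J.Nonempty := Finset.card_pos.1 (by omega)
    have hbm : J.max' hJne < m := by
      obtain ⟨i, -, hi⟩ := (hJ _).1 (J.max'_mem hJne)
      omega
    let τ : ℕ → ℕ := fun j => if hj : j < m then σ ⟨j, hj⟩ + 1 - m else 0
    have hτ : ∀ i : Fin m, τ i = σ i + 1 - m := fun i => by
      simp [τ]
    have hE : ∀ i ∈ L, E i = D i := by
      intro i hi
      ext x
      refine ⟨?_, fun hx => ⟨i, hi, rfl, hx⟩⟩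
      rintro ⟨j, -, hj, hx⟩
      exact Fin.ext hj ▸ hx
    have hE' : ∀ j, (∀ i ∈ L, (i : ℕ) ≠ j) → E j = ∅ := fun j hj =>
      Set.eq_empty_of_forall_notMem fun x ⟨i, hi, hij, _⟩ => hj i hi hij
    have hME : ∀ i < 3 * m - 1, ∀ j, Disjoint (M i) (E j) := fun i hi j =>
      Set.disjoint_right.2 fun x ⟨i', _, _, hx⟩ => Set.disjoint_right.1 (h.disjoint_link i hi i') hx
    have hEE : ∀ i j, i ≠ j → Disjoint (E i) (E j) := by
      intro i j hij
      refine Set.disjoint_left.2 ?_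
      rintro x ⟨i', -, rfl, hx⟩ ⟨j', -, rfl, hx'⟩
      exact Set.disjoint_left.1 (h.link_disjoint i' j' fun e => hij (congrArg _ e)) hx hx'
    have hIL : ∀ x, (∃ i ∈ I, x ∈ D i) → (∀ j, x ∉ E j) ∧ ∀ i < 3 * m - 1, x ∉ M i := by
      rintro x ⟨i, hi, hx⟩
      refine ⟨?_, fun j hj hx' => Set.disjoint_left.1 (h.disjoint_link j hj i) hx' hx⟩
      rintro j ⟨i', hi', -, hx'⟩
      refine Set.disjoint_left.1 (h.link_disjoint i i' ?_) hx hx'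
      rintro rfl
      exact (hLI i hi').1 hi
    have := hheap.exists_doubleWheel (f := fun i => M i ∪ E i) (a := J.min' hJne)
      (b := J.max' hJne) (H := {x | ∃ i ∈ I, x ∈ D i}) (J := J) (τ := τ)
      (fun i hi => by
        have hi := hi.2
        by_cases hiL : ∃ i' ∈ L, (i' : ℕ) = i
        · obtain ⟨i', hi', rfl⟩ := hiL
          rw [hE i' hi']
          obtain ⟨x, hx, y, hy, hxy⟩ := h.touch_start i'
          exact (h.connSet i' (by omega)).union_of_adj (h.link_connSet i') hx hy hxy
        · push Not at hiL
          rw [hE' i hiL, Set.union_empty]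
          exact h.connSet i (by omega))
      (fun i hi j hj hij => by
        have hi := hi.2
        have hj := hj.2
        rw [Set.disjoint_union_left, Set.disjoint_union_right, Set.disjoint_union_right]
        exact ⟨⟨h.disjoint i (by omega) j (by omega) hij, hME i (by omega) j⟩,
          (hME j (by omega) i).symm, hEE i j hij⟩)
      (fun i _ hi => (hpath i (by omega)).mono Set.subset_union_left Set.subset_union_left)
      (hI.iUnion_of_adj (fun i _ => h.link_connSet i) fun i _ j _ hij => hij.2)
      (fun i hi => Set.disjoint_right.2 fun x hx hx' => hx'.elim
        ((hIL x hx).2 i (by have := hi.2; omega)) ((hIL x hx).1 i))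
      (fun i h0 hi j hj => by
        have hj := hj.2
        rw [Set.disjoint_union_right]
        exact ⟨h.disjoint _ (by omega) _ (by omega) (by omega), hME _ (by omega) _⟩)
      (fun i h0 hi => Set.disjoint_right.2 fun x hx => (hIL x hx).2 _ (by omega))
      (fun j hj => ⟨J.min'_le j hj, J.le_max' j hj⟩) (J.min'_mem hJne) (J.max'_mem hJne)
      (by omega)
      (fun j hj => by
        obtain ⟨i, hi, rfl⟩ := (hJ j).1 hj
        obtain ⟨i', hi', hii⟩ := (hLI i hi).2
        rw [hE i hi]
        exact Touch.mono hii.symm.2 Set.subset_union_right fun x hx => ⟨i', hi', hx⟩)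
      (fun j hj => by
        obtain ⟨i, hi, rfl⟩ := (hJ j).1 hj
        rw [hτ]
        exact hleaf i)
      (fun j hj => by
        obtain ⟨i, hi, rfl⟩ := (hJ j).1 hj
        rw [hτ, hE i hi, hleaf']
        exact (h.touch_end i).symm.mono Set.subset_union_right subset_rfl)
      (fun i hi j hj hij => by
        obtain ⟨i, hi, rfl⟩ := (hJ _).1 hi
        obtain ⟨j, hj, rfl⟩ := (hJ _).1 hj
        rw [hτ, hτ] at hij
        have h1 := hleaf' i
        have h2 := hleaf' j
        exact congrArg _ (h.injective (by rw [← h1, ← h2, hij])))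
    obtain ⟨r, hr, hminor⟩ := this
    exact ⟨r, by omega, hminor⟩

end Extraction

section Estimates

open Real

theorem natCast_le_mul_logb_two {x p q : ℕ} (h : 2 ^ p ≤ x ^ q) :
    (p : ℝ) ≤ q * logb 2 x := by
  have h1 : (2 : ℝ) ^ p ≤ (x : ℝ) ^ q := by exact_mod_cast h
  have h2 := logb_le_logb_of_le (b := 2) (by norm_num) (by positivity) h1
  rwa [logb_pow, logb_pow, logb_self_eq_one (by norm_num), mul_one] at h2

theorem mul_logb_two_le_natCast {x p q : ℕ} (hx : 0 < x) (h : x ^ q ≤ 2 ^ p) :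
    q * logb 2 x ≤ (p : ℝ) := by
  have h1 : (x : ℝ) ^ q ≤ (2 : ℝ) ^ p := by exact_mod_cast h
  have h2 := logb_le_logb_of_le (b := 2) (by norm_num) (by positivity) h1
  rwa [logb_pow, logb_pow, logb_self_eq_one (by norm_num), mul_one] at h2

theorem sqrt_sub_two_div_le_three {l : ℕ} (hl : 0 < l) (hl' : l < 2048) :
    (√l - 2) / (2 * logb 2 l - 5) ≤ 3 := by
  have hl1 : (1 : ℝ) ≤ l := by exact_mod_cast hl
  have hs1 : 1 ≤ √(l : ℝ) := Real.one_le_sqrt.2 hl1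
  rcases lt_or_ge l 8 with h8 | h8
  · have hsmall : l ≤ 4 ∨ l = 5 ∨ l = 6 ∨ l = 7 := by omega
    rcases hsmall with h4 | rfl | rfl | rfl
    · have h1 := mul_logb_two_le_natCast (x := l) (p := 2) (q := 1) hl (by rw [pow_one]; omega)
      push_cast at h1
      rw [div_le_iff_of_neg (by linarith)]
      linarith
    · have h1 := mul_logb_two_le_natCast (x := 5) (p := 5) (q := 2) (by norm_num) (by norm_num)
      have h2 : 2 ≤ √((5 : ℕ) : ℝ) := Real.le_sqrt_of_sq_le (by norm_num)
      push_cast at h1 h2 ⊢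
      exact (div_nonpos_of_nonneg_of_nonpos (by linarith) (by linarith)).trans (by norm_num)
    · have h1 := natCast_le_mul_logb_two (x := 6) (p := 103) (q := 40) (by norm_num)
      have h2 : √((6 : ℕ) : ℝ) ≤ 2.45 := Real.sqrt_le_iff.2 (by norm_num)
      push_cast at h1 h2 ⊢
      rw [div_le_iff₀ (by linarith)]
      linarith
    · have h1 := natCast_le_mul_logb_two (x := 7) (p := 14) (q := 5) (by norm_num)
      have h2 : √((7 : ℕ) : ℝ) ≤ 2.65 := Real.sqrt_le_iff.2 (by norm_num)
      push_cast at h1 h2 ⊢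
      rw [div_le_iff₀ (by linarith)]
      linarith
  · have ha := Nat.pow_log_le_self 2 hl.ne'
    have hb := Nat.lt_pow_succ_log_self (b := 2) (by norm_num) l
    have ha3 : 3 ≤ Nat.log 2 l := Nat.le_log_of_pow_le (by norm_num) (by omega)
    have ha10 : Nat.log 2 l < 11 := Nat.log_lt_of_lt_pow hl.ne' (by omega)
    have h1 := natCast_le_mul_logb_two (x := l) (p := Nat.log 2 l) (q := 1) (by rwa [pow_one])
    generalize Nat.log 2 l = a at *
    have h2 : l ≤ (6 * a - 13) ^ 2 := by
      refine hb.le.trans ?_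
      clear hb ha h1
      interval_cases a <;> norm_num
    have h3 : √(l : ℝ) ≤ 6 * a - 13 := by
      have h4 : ((6 * a - 13 : ℕ) : ℝ) = 6 * a - 13 := by
        rw [Nat.cast_sub (by omega)]
        push_cast
        ring
      rw [← h4]
      exact Real.sqrt_le_iff.2 ⟨by positivity, by exact_mod_cast h2⟩
    have h4 : (3 : ℝ) ≤ a := by exact_mod_cast ha3
    push_cast at h1
    rw [div_le_iff₀ (by linarith)]
    linarith

theorem sqrt_sub_two_div_le {l n r : ℕ} (hl : 2048 ≤ l) (hn : 3 * l - 1 ≤ n ^ 2)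
    (hr : n ≤ 2 * Nat.log 2 (2 * (3 * l - 1) - 1) * r + 2) :
    (√l - 2) / (2 * logb 2 l - 5) ≤ r := by
  have h1 := natCast_le_mul_logb_two (x := l) (p := 11) (q := 1) (by rw [pow_one]; omega)
  have h2 := mul_logb_two_le_natCast (x := 6) (p := 13) (q := 5) (by norm_num) (by norm_num)
  push_cast at h1 h2
  have hl0 : (2048 : ℝ) ≤ l := by exact_mod_cast hl
  have hs0 : 0 ≤ √(l : ℝ) := Real.sqrt_nonneg _
  have hs : √(l : ℝ) ^ 2 = l := Real.sq_sqrt (by positivity)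
  have h3 : (Nat.log 2 (2 * (3 * l - 1) - 1) : ℝ) ≤ logb 2 l + 2.6 := by
    have h4 : 2 ^ Nat.log 2 (2 * (3 * l - 1) - 1) ≤ (6 * l) ^ 1 :=
      (Nat.pow_log_le_self 2 (by omega)).trans (by rw [pow_one]; omega)
    have h5 := natCast_le_mul_logb_two h4
    push_cast at h5
    rw [Real.logb_mul (by norm_num) (by positivity)] at h5
    linarith
  have h4 : 1.7 * √(l : ℝ) ≤ n := by
    have h5 : 3 * (l : ℝ) ≤ (n : ℝ) ^ 2 + 1 := by exact_mod_cast (by omega : 3 * l ≤ n ^ 2 + 1)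
    refine abs_le_of_sq_le_sq' ?_ (Nat.cast_nonneg n) |>.2
    nlinarith
  have h5 : (n : ℝ) ≤ 2 * Nat.log 2 (2 * (3 * l - 1) - 1) * r + 2 := by exact_mod_cast hr
  have h6 : 1.7 * √(l : ℝ) - 2 ≤ r * (2 * (logb 2 l + 2.6)) := by
    have := mul_le_mul_of_nonneg_right h3 (Nat.cast_nonneg (α := ℝ) r)
    linarith
  rw [← div_le_iff₀ (by linarith)] at h6
  refine le_trans ?_ h6
  rw [div_le_div_iff₀ (by linarith) (by linarith)]
  nlinarith

end Estimates

/-- Large treewidth yields sets arranged along any prescribed tree and linked from its first to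
its last nodes. -/
theorem exists_isTreeLinkage_of_le_treewidth {V : Type*} [Fintype V] {G : SimpleGraph V}
    {k w m : ℕ} (hk : k ≤ treewidth G) (par : ℕ → ℕ) (hm : 0 < m) (hmw : 2 * m ≤ w)
    (hwk : w + m ≤ k + 1) : ∃ M D σ, IsTreeLinkage G par w m M D σ := by
  obtain ⟨𝔅, h𝔅, hcov⟩ := exists_bramble_of_le_treewidth (by omega) hk
  exact exists_isTreeLinkage h𝔅 hcov par hm hmw hwk

end DoubleWheelMinor

open DoubleWheelMinor

/-- If `l > 0` and `tw(G) ≥ 12l - 4`, then `G` contains as a minor a double wheel of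
order `r` for some integer `r > 2` with `r ≥ (√l - 2)/(2·log₂ l - 5)`. -/
theorem doubleWheel_minor_of_treewidth_linear {V : Type*} [Fintype V] (l : ℕ) (hl : 0 < l)
    (G : SimpleGraph V) (htw : treewidth G ≥ 12 * l - 4) :
    ∃ r : ℕ, 2 < r ∧
      (r : ℝ) ≥ (Real.sqrt l - 2) / (2 * Real.logb 2 l - 5) ∧
      IsMinor (doubleWheel r) G := by
  rcases le_or_gt ((Real.sqrt l - 2) / (2 * Real.logb 2 l - 5)) 3 with h3 | h3
  · obtain ⟨M, D, σ, h⟩ := exists_isTreeLinkage_of_le_treewidth htw (fun i => i - 1) (w := 6)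
      (m := 3) (by omega) (by omega) (by omega)
    exact ⟨3, by omega, by exact_mod_cast h3, h.isMinor_doubleWheel_three⟩
  · have hl' : 2048 ≤ l := by
      by_contra! hlt
      exact h3.not_ge (sqrt_sub_two_div_le_three hl hlt)
    obtain ⟨M, D, σ, h⟩ := exists_isTreeLinkage_of_le_treewidth htw (pathHeapParent (3 * l - 1))
      (w := 3 * (3 * l - 1) - 1) (m := 3 * l - 1) (by omega) (by omega) (by omega)
    have hn : 2 < Nat.sqrt (3 * l - 2) + 1 := by
      have : 2 ≤ Nat.sqrt (3 * l - 2) := Nat.le_sqrt'.2 (by omega)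
      omega
    obtain ⟨r, hr, hminor⟩ := h.exists_doubleWheel hn (by
      have := Nat.sqrt_le' (3 * l - 2)
      rw [Nat.add_sub_cancel]
      omega)
    have hratio := sqrt_sub_two_div_le hl' (by
      have := Nat.lt_succ_sqrt' (3 * l - 2)
      rw [Nat.succ_eq_add_one] at this
      omega) hr
    have hr3 : (3 : ℝ) < r := h3.trans_le hratio
    have : 3 < r := by exact_mod_cast hr3
    exact ⟨r, by omega, hratio, hminor⟩
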